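/- arXiv:1504.07618 — 2 statements merged into one kernel-verified Lean document; each statement's English description precedes it below -/
import Mathlib

section
/- Let ℓ be an odd prime and let G be a subgroup of GL₂(ℤ/ℓℤ) with dihedral projective image. Then G is conjugate in GL₂(ℓ) both to a subgroup of C_s⁺(ℓ) and to a subgroup of C_ns⁺(ℓ) if and only if G is conjugate to H_z := ⟨[[0,1],[z,0]], [[1,0],[0,−1]]⟩ for some non-square z ∈ (ℤ/ℓℤ)ˣ, in which case the image of G in PGL₂(ℓ) is the Klein four-group of order 4. Moreover, the number of conjugacy classes of such subgroups G equals the number of odd positive divisors of ℓ − 1. -/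
open Matrix Pointwise

/-- `GL₂(ℤ/ℓℤ)`. -/
abbrev GL2 (ℓ : ℕ) := GL (Fin 2) (ZMod ℓ)

/-- The underlying matrix of an element of `GL₂(ℤ/ℓℤ)`. -/
def mat {ℓ : ℕ} (g : GL2 ℓ) : Matrix (Fin 2) (Fin 2) (ZMod ℓ) := g

/-- Membership in the split Cartan group `C_s(ℓ)` of diagonal matrices. -/
def IsDiagElt {ℓ : ℕ} (g : GL2 ℓ) : Prop := mat g 0 1 = 0 ∧ mat g 1 0 = 0

/-- Antidiagonal matrices: the nontrivial coset of `C_s(ℓ)` in its normalizer. -/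
def IsAntidiagElt {ℓ : ℕ} (g : GL2 ℓ) : Prop := mat g 0 0 = 0 ∧ mat g 1 1 = 0

/-- Membership in `C_s⁺(ℓ)`, the normalizer of `C_s(ℓ)` in `GL₂(ℤ/ℓℤ)`. -/
def IsCsPlusElt {ℓ : ℕ} (g : GL2 ℓ) : Prop := IsDiagElt g ∨ IsAntidiagElt g

/-- Membership in the non-split Cartan group `C_ns(ℓ)`: matrices `[[x, εy],[y, x]]`. -/
def IsNSElt {ℓ : ℕ} (ε : ZMod ℓ) (g : GL2 ℓ) : Prop :=
  mat g 1 1 = mat g 0 0 ∧ mat g 0 1 = ε * mat g 1 0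

/-- Membership in the nontrivial coset `[[1,0],[0,−1]]·C_ns(ℓ)`. -/
def IsNSCosetElt {ℓ : ℕ} (ε : ZMod ℓ) (g : GL2 ℓ) : Prop :=
  mat g 1 1 = -mat g 0 0 ∧ mat g 0 1 = -(ε * mat g 1 0)

/-- Membership in `C_ns⁺(ℓ)`, the normalizer of `C_ns(ℓ)` in `GL₂(ℤ/ℓℤ)`. -/
def IsNSPlusElt {ℓ : ℕ} (ε : ZMod ℓ) (g : GL2 ℓ) : Prop :=
  IsNSElt ε g ∨ IsNSCosetElt ε g

/-- The subgroup `H_z = ⟨[[0,1],[z,0]], [[1,0],[0,−1]]⟩` of `GL₂(ℤ/ℓℤ)`. -/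
def Hz {ℓ : ℕ} (z : ZMod ℓ) : Subgroup (GL2 ℓ) :=
  Subgroup.closure {g : GL2 ℓ | mat g = !![0, 1; z, 0] ∨ mat g = !![1, 0; 0, -1]}

/-- The image of a subgroup of `GL₂(ℤ/ℓℤ)` in `PGL₂(ℤ/ℓℤ)`, the quotient of
`GL₂(ℤ/ℓℤ)` by its center `Z(ℓ)`. -/
def projImage {ℓ : ℕ} (G : Subgroup (GL2 ℓ)) :
    Subgroup ((GL2 ℓ) ⧸ Subgroup.center (GL2 ℓ)) :=
  G.map (QuotientGroup.mk' (Subgroup.center (GL2 ℓ)))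

/-- A subgroup of `GL₂(ℤ/ℓℤ)` has dihedral projective image if its image in `PGL₂(ℤ/ℓℤ)`
is isomorphic to the dihedral group of order `2m` for some `m ≥ 2` (the Klein four-group,
`m = 2`, counts as dihedral). -/
def IsDihedralProj {ℓ : ℕ} (G : Subgroup (GL2 ℓ)) : Prop :=
  ∃ m : ℕ, 2 ≤ m ∧ Nonempty (↥(projImage G) ≃* DihedralGroup m)

/-- The number of conjugacy classes of subgroups satisfying `P`, i.e. the number of orbits
of the conjugation action on `{H : Subgroup G // P H}`. -/
noncomputable def conjClassCount {G : Type*} [Group G] (P : Subgroup G → Prop) : ℕ :=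
  Nat.card (Quotient (Setoid.comap (Subtype.val : {H : Subgroup G // P H} → Subgroup G)
    (MulAction.orbitRel (ConjAct G) (Subgroup G))))

theorem ZMod.isSquare_units_mul_of_not_isSquare {ℓ : ℕ} [Fact ℓ.Prime] (hodd : Odd ℓ)
    {u v : (ZMod ℓ)ˣ} (hu : ¬ IsSquare u) (hv : ¬ IsSquare v) : IsSquare (u * v) := by
  have hF : ringChar (ZMod ℓ) ≠ 2 := by
    rw [ZMod.ringChar_zmod_n]; rintro rfl; exact absurd hodd (by decide)
  have key : ∀ w : (ZMod ℓ)ˣ, ¬ IsSquare w → w ^ (Fintype.card (ZMod ℓ) / 2) = -1 := by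
    intro w hw
    rw [FiniteField.unit_isSquare_iff hF] at hw
    rcases ZMod.pow_div_two_eq_neg_one_or_one ℓ w.ne_zero with h | h
    · exact absurd (Units.ext (by simpa using h)) hw
    · exact Units.ext (by simpa using h)
  rw [FiniteField.unit_isSquare_iff hF, mul_pow, key u hu, key v hv, neg_mul_neg, one_mul]

theorem ZMod.not_isSquare_val_units {ℓ : ℕ} [Fact ℓ.Prime] {u : (ZMod ℓ)ˣ} :
    ¬ IsSquare (u : ZMod ℓ) ↔ ¬ IsSquare u := by
  refine not_congr ⟨?_, fun h => h.map (Units.coeHom (ZMod ℓ))⟩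
  rintro ⟨y, hy⟩
  have hy0 : y ≠ 0 := by
    rintro rfl
    simp at hy
  exact ⟨Units.mk0 y hy0, Units.ext (by simpa using hy)⟩

theorem Subgroup.mem_of_sq_mem_of_not_isSquare {ℓ : ℕ} [Fact ℓ.Prime] (hodd : Odd ℓ)
    {S : Subgroup (ZMod ℓ)ˣ} {n : (ZMod ℓ)ˣ} (hn : ¬ IsSquare n) (hnS : n ∈ S)
    {s : (ZMod ℓ)ˣ} (hs : s ^ 2 ∈ S) : s ∈ S := by
  have hsurj : Function.Surjective (fun q : (ZMod ℓ)ˣ ⧸ S => q ^ 2) := by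
    intro q
    obtain ⟨u, rfl⟩ := QuotientGroup.mk_surjective q
    by_cases hu : IsSquare u
    · obtain ⟨w, rfl⟩ := hu
      exact ⟨w, by simp [sq]⟩
    · obtain ⟨w, hw⟩ := ZMod.isSquare_units_mul_of_not_isSquare hodd hu hn
      refine ⟨w, ?_⟩
      simp only
      rw [sq, ← QuotientGroup.mk_mul, ← hw, QuotientGroup.mk_mul,
        (QuotientGroup.eq_one_iff n).2 hnS, mul_one]
  have hinj := Finite.injective_iff_surjective.2 hsurj
  rw [← QuotientGroup.eq_one_iff]
  apply hinj
  simp only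
  rw [← QuotientGroup.mk_pow, (QuotientGroup.eq_one_iff _).2 hs, one_pow]

theorem ZMod.not_isSquare_of_mem_zpowers {ℓ : ℕ} [Fact ℓ.Prime]
    {g n : (ZMod ℓ)ˣ} (hn : ¬ IsSquare n) (h : n ∈ Subgroup.zpowers g) : ¬ IsSquare g := by
  obtain ⟨k, rfl⟩ := h
  exact fun hg => hn (hg.zpow k)

theorem Subgroup.exists_sq_mul_eq_of_zpowers_eq {ℓ : ℕ} [Fact ℓ.Prime] (hodd : Odd ℓ)
    {S : Subgroup (ZMod ℓ)ˣ} {g n : (ZMod ℓ)ˣ} (hg : Subgroup.zpowers g = S)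
    (hn : ¬ IsSquare n) (hnS : n ∈ S) : ∃ w ∈ S, w ^ 2 * n = g := by
  have hg' : ¬ IsSquare g := ZMod.not_isSquare_of_mem_zpowers hn (hg ▸ hnS)
  have hn' : ¬ IsSquare n⁻¹ := fun h => hn (by simpa using h.inv)
  obtain ⟨w, hw⟩ := ZMod.isSquare_units_mul_of_not_isSquare hodd hg' hn'
  have hgS : g ∈ S := hg ▸ Subgroup.mem_zpowers g
  refine ⟨w, Subgroup.mem_of_sq_mem_of_not_isSquare hodd hn hnS ?_, ?_⟩
  · rw [sq, ← hw]; exact S.mul_mem hgS (S.inv_mem hnS)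
  · rw [sq, ← hw]; simp

theorem ZMod.neg_one_mem_zpowers_of_not_isSquare {ℓ : ℕ} [Fact ℓ.Prime] (hodd : Odd ℓ)
    {z : (ZMod ℓ)ˣ} (hz : ¬ IsSquare z) : -1 ∈ Subgroup.zpowers z :=
  Subgroup.mem_of_sq_mem_of_not_isSquare hodd hz (Subgroup.mem_zpowers z)
    (by simp)

theorem Subgroup.odd_index_of_not_isSquare_mem {ℓ : ℕ} [Fact ℓ.Prime] (hodd : Odd ℓ)
    {S : Subgroup (ZMod ℓ)ˣ} {n : (ZMod ℓ)ˣ} (hn : ¬ IsSquare n) (hnS : n ∈ S) :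
    Odd S.index := by
  by_contra h
  rw [Nat.not_odd_iff_even, even_iff_two_dvd, Subgroup.index] at h
  have : Fact (Nat.Prime 2) := ⟨Nat.prime_two⟩
  obtain ⟨q, hq⟩ := exists_prime_orderOf_dvd_card' 2 h
  obtain ⟨u, rfl⟩ := QuotientGroup.mk_surjective q
  have h2 : u ^ 2 ∈ S := by
    rw [← QuotientGroup.eq_one_iff, QuotientGroup.mk_pow, ← hq, pow_orderOf_eq_one]
  have h1 := (QuotientGroup.eq_one_iff u).2
    (Subgroup.mem_of_sq_mem_of_not_isSquare hodd hn hnS h2)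
  rw [h1, orderOf_one] at hq
  exact absurd hq (by norm_num)

theorem ZMod.exists_not_isSquare_index_zpowers {ℓ : ℕ} [Fact ℓ.Prime] (hodd : Odd ℓ)
    {d : ℕ} (hd : Odd d) (hdvd : d ∣ ℓ - 1) :
    ∃ z : (ZMod ℓ)ˣ, ¬ IsSquare z ∧ (Subgroup.zpowers z).index = d := by
  obtain ⟨g, hg⟩ := IsCyclic.exists_generator (α := (ZMod ℓ)ˣ)
  have hcard : Nat.card (ZMod ℓ)ˣ = ℓ - 1 := by
    rw [Nat.card_eq_fintype_card, ZMod.card_units]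
  have hord : orderOf g = ℓ - 1 := by rw [orderOf_eq_card_of_forall_mem_zpowers hg, hcard]
  have hpos : 0 < ℓ - 1 := Nat.sub_pos_of_lt (Fact.out : ℓ.Prime).one_lt
  have heven : 2 ∣ ℓ - 1 := by obtain ⟨k, rfl⟩ := hodd; exact ⟨k, by omega⟩
  refine ⟨g ^ d, ?_, ?_⟩
  · rintro ⟨w, hw⟩
    obtain ⟨k, rfl⟩ := hg w
    simp only at hw
    rw [← zpow_natCast, ← _root_.zpow_add, zpow_eq_zpow_iff_modEq, hord] at hw
    have h2 : (2 : ℤ) ∣ k + k - d := (Int.natCast_dvd_natCast.2 heven).trans hw.dvd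
    obtain ⟨m, rfl⟩ := hd
    push_cast at h2
    omega
  · have h := (Subgroup.zpowers (g ^ d)).card_mul_index
    rw [Nat.card_zpowers, orderOf_pow_of_dvd (Nat.pos_of_dvd_of_pos hdvd hpos).ne'
      (hord ▸ hdvd), hord, hcard] at h
    have hq : 0 < (ℓ - 1) / d := Nat.div_pos (Nat.le_of_dvd hpos hdvd)
      (Nat.pos_of_dvd_of_pos hdvd hpos)
    exact Nat.eq_of_mul_eq_mul_left hq (h.trans (Nat.div_mul_cancel hdvd).symm)

theorem Subgroup.eq_of_index_eq_of_isCyclic {C : Type*} [CommGroup C] [Finite C] [IsCyclic C]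
    {S T : Subgroup C} (h : S.index = T.index) : S = T := by
  classical
  have := Fintype.ofFinite C
  have hcard : Nat.card S = Nat.card T := by
    have h1 := S.card_mul_index
    rw [h, ← T.card_mul_index] at h1
    exact Nat.eq_of_mul_eq_mul_right (Nat.pos_of_ne_zero T.index_ne_zero_of_finite) h1
  have key : ∀ R : Subgroup C, (R : Set C) = {x | x ^ Nat.card R = 1} := by
    intro R
    refine Set.eq_of_subset_of_ncard_le (fun x hx => ?_) ?_ (Set.toFinite _)
    · exact orderOf_dvd_iff_pow_eq_one.1 (R.orderOf_dvd_natCard hx)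
    · rw [Set.ncard_eq_toFinset_card', ← Nat.card_coe_set_eq]
      simpa using IsCyclic.card_pow_eq_one_le (α := C) (n := Nat.card R) Nat.card_pos
  exact SetLike.coe_injective (by rw [key S, key T, hcard])

section CartanElements

variable {ℓ : ℕ}

/-- The diagonal matrix with unit entries `a`, `b`. -/
def diagElt (a b : (ZMod ℓ)ˣ) : GL2 ℓ where
  val := !![(a : ZMod ℓ), 0; 0, (b : ZMod ℓ)]
  inv := !![((a⁻¹ : (ZMod ℓ)ˣ) : ZMod ℓ), 0; 0, ((b⁻¹ : (ZMod ℓ)ˣ) : ZMod ℓ)]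
  val_inv := by ext i j; fin_cases i <;> fin_cases j <;> simp
  inv_val := by ext i j; fin_cases i <;> fin_cases j <;> simp

/-- The antidiagonal matrix with unit entries `a`, `b`. -/
def antiElt (a b : (ZMod ℓ)ˣ) : GL2 ℓ where
  val := !![0, (a : ZMod ℓ); (b : ZMod ℓ), 0]
  inv := !![0, ((b⁻¹ : (ZMod ℓ)ˣ) : ZMod ℓ); ((a⁻¹ : (ZMod ℓ)ˣ) : ZMod ℓ), 0]
  val_inv := by ext i j; fin_cases i <;> fin_cases j <;> simp
  inv_val := by ext i j; fin_cases i <;> fin_cases j <;> simp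

theorem mat_injective : Function.Injective (mat : GL2 ℓ → _) := fun _ _ h => Units.ext h

theorem mat_mul (x y : GL2 ℓ) : mat (x * y) = mat x * mat y := rfl

theorem mat_diagElt (a b : (ZMod ℓ)ˣ) : mat (diagElt a b) = !![(a : ZMod ℓ), 0; 0, (b : ZMod ℓ)] :=
  rfl

theorem mat_antiElt (a b : (ZMod ℓ)ˣ) : mat (antiElt a b) = !![0, (a : ZMod ℓ); (b : ZMod ℓ), 0] :=
  rfl

theorem diagElt_mul_diagElt (a b c d : (ZMod ℓ)ˣ) :
    diagElt a b * diagElt c d = diagElt (a * c) (b * d) :=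
  mat_injective (by rw [mat_mul]; simp [mat_diagElt])

theorem diagElt_mul_antiElt (a b c d : (ZMod ℓ)ˣ) :
    diagElt a b * antiElt c d = antiElt (a * c) (b * d) :=
  mat_injective (by rw [mat_mul]; simp [mat_diagElt, mat_antiElt])

theorem antiElt_mul_diagElt (a b c d : (ZMod ℓ)ˣ) :
    antiElt a b * diagElt c d = antiElt (a * d) (b * c) :=
  mat_injective (by rw [mat_mul]; simp [mat_diagElt, mat_antiElt])

theorem antiElt_mul_antiElt (a b c d : (ZMod ℓ)ˣ) :
    antiElt a b * antiElt c d = diagElt (a * d) (b * c) :=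
  mat_injective (by rw [mat_mul]; simp [mat_diagElt, mat_antiElt])

theorem diagElt_inv (a b : (ZMod ℓ)ˣ) : (diagElt a b)⁻¹ = diagElt a⁻¹ b⁻¹ := rfl

theorem antiElt_inv (a b : (ZMod ℓ)ˣ) : (antiElt a b)⁻¹ = antiElt b⁻¹ a⁻¹ := rfl

theorem scalar_eq_diagElt (a : (ZMod ℓ)ˣ) :
    GeneralLinearGroup.scalar (Fin 2) a = diagElt a a := by
  refine mat_injective ?_
  ext i j
  fin_cases i <;> fin_cases j <;> simp [mat, diagElt, GeneralLinearGroup.scalar]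

theorem diagElt_one : (diagElt 1 1 : GL2 ℓ) = 1 := by
  rw [← scalar_eq_diagElt, map_one]

theorem mem_center_iff_exists_diagElt {x : GL2 ℓ} :
    x ∈ Subgroup.center (GL2 ℓ) ↔ ∃ u, x = diagElt u u := by
  rw [GeneralLinearGroup.center_eq_range_scalar]
  simp only [MonoidHom.mem_range, scalar_eq_diagElt, eq_comm]

theorem diagElt_inj {a b c d : (ZMod ℓ)ˣ} : diagElt a b = diagElt c d ↔ a = c ∧ b = d := by
  refine ⟨fun h => ?_, fun ⟨h, h'⟩ => by rw [h, h']⟩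
  have h := congrArg mat h
  rw [mat_diagElt, mat_diagElt] at h
  exact ⟨Units.ext (congrFun (congrFun h 0) 0), Units.ext (congrFun (congrFun h 1) 1)⟩

theorem diagElt_mem_center_iff {a b : (ZMod ℓ)ˣ} :
    diagElt a b ∈ Subgroup.center (GL2 ℓ) ↔ a = b := by
  simp only [mem_center_iff_exists_diagElt, diagElt_inj]
  exact ⟨fun ⟨u, h, h'⟩ => h.trans h'.symm, fun h => ⟨b, h, rfl⟩⟩

theorem diagElt_ne_antiElt [Nontrivial (ZMod ℓ)] (a b c d : (ZMod ℓ)ˣ) :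
    diagElt a b ≠ antiElt c d := by
  intro h
  have h := congrFun (congrFun (congrArg mat h) 0) 0
  simp [mat_diagElt, mat_antiElt] at h

theorem antiElt_notMem_center [Nontrivial (ZMod ℓ)] (a b : (ZMod ℓ)ˣ) :
    antiElt a b ∉ Subgroup.center (GL2 ℓ) := by
  rw [mem_center_iff_exists_diagElt]
  rintro ⟨u, h⟩
  exact diagElt_ne_antiElt _ _ _ _ h.symm

theorem trace_mat_conj (c x : GL2 ℓ) : (mat (c * x * c⁻¹)).trace = (mat x).trace := by
  simp only [mat, Units.val_mul]
  rw [Matrix.trace_mul_comm, ← mul_assoc, ← Units.val_mul, inv_mul_cancel, Units.val_one, one_mul]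

theorem det_mat_conj (c x : GL2 ℓ) : (mat (c * x * c⁻¹)).det = (mat x).det := by
  change (GeneralLinearGroup.det (c * x * c⁻¹) : ZMod ℓ) = GeneralLinearGroup.det x
  rw [map_mul, map_mul, map_inv, mul_inv_cancel_comm]

theorem conj_mem_center_iff {G : Type*} [Group G] {c x : G} :
    c * x * c⁻¹ ∈ Subgroup.center G ↔ x ∈ Subgroup.center G :=
  (Subgroup.Normal.mem_comm_iff inferInstance).trans (by rw [inv_mul_cancel_left])

theorem det_mat_ne_zero [Fact ℓ.Prime] (x : GL2 ℓ) : (mat x).det ≠ 0 :=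
  (GeneralLinearGroup.det x).ne_zero

theorem IsDiagElt.exists_eq_diagElt [Fact ℓ.Prime] {x : GL2 ℓ} (hx : IsDiagElt x) :
    ∃ a b, x = diagElt a b := by
  obtain ⟨h1, h2⟩ := hx
  have h := det_mat_ne_zero x
  rw [Matrix.det_fin_two, h1, zero_mul, sub_zero] at h
  refine ⟨Units.mk0 _ (left_ne_zero_of_mul h), Units.mk0 _ (right_ne_zero_of_mul h),
    mat_injective ?_⟩
  refine (Matrix.eta_fin_two (mat x)).trans ?_
  rw [h1, h2]
  rfl

theorem IsAntidiagElt.exists_eq_antiElt [Fact ℓ.Prime] {x : GL2 ℓ} (hx : IsAntidiagElt x) :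
    ∃ a b, x = antiElt a b := by
  obtain ⟨h1, h2⟩ := hx
  have h := det_mat_ne_zero x
  rw [Matrix.det_fin_two, h1, zero_mul, zero_sub, neg_ne_zero] at h
  refine ⟨Units.mk0 _ (left_ne_zero_of_mul h), Units.mk0 _ (right_ne_zero_of_mul h),
    mat_injective ?_⟩
  refine (Matrix.eta_fin_two (mat x)).trans ?_
  rw [h1, h2]
  rfl

theorem isCsPlusElt_iff [Fact ℓ.Prime] {x : GL2 ℓ} :
    IsCsPlusElt x ↔ ∃ a b, x = diagElt a b ∨ x = antiElt a b := by
  constructor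
  · rintro (h | h)
    · obtain ⟨a, b, h⟩ := h.exists_eq_diagElt
      exact ⟨a, b, .inl h⟩
    · obtain ⟨a, b, h⟩ := h.exists_eq_antiElt
      exact ⟨a, b, .inr h⟩
  · rintro ⟨a, b, rfl | rfl⟩
    · exact .inl ⟨rfl, rfl⟩
    · exact .inr ⟨rfl, rfl⟩

/-- The group of units `u` such that the scalar matrix `u` lies in `G`. -/
def scalarPart (G : Subgroup (GL2 ℓ)) : Subgroup (ZMod ℓ)ˣ :=
  G.comap (GeneralLinearGroup.scalar (Fin 2))

theorem mem_scalarPart {G : Subgroup (GL2 ℓ)} {u : (ZMod ℓ)ˣ} :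
    u ∈ scalarPart G ↔ diagElt u u ∈ G := by
  rw [scalarPart, Subgroup.mem_comap, scalar_eq_diagElt]

theorem mem_map_conj_iff {G : Type*} [Group G] {c x : G} {H : Subgroup G} :
    x ∈ H.map (MulAut.conj c).toMonoidHom ↔ c⁻¹ * x * c ∈ H := by
  constructor
  · rintro ⟨y, hy, rfl⟩
    simpa [mul_assoc] using hy
  · exact fun h => ⟨_, h, by simp [mul_assoc]⟩

theorem map_conj_map_conj {G : Type*} [Group G] (c d : G) (H : Subgroup G) :
    (H.map (MulAut.conj c).toMonoidHom).map (MulAut.conj d).toMonoidHom =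
      H.map (MulAut.conj (d * c)).toMonoidHom := by
  ext x
  simp only [mem_map_conj_iff, _root_.mul_inv_rev, mul_assoc]

theorem scalarPart_map_conj (c : GL2 ℓ) (G : Subgroup (GL2 ℓ)) :
    scalarPart (G.map (MulAut.conj c).toMonoidHom) = scalarPart G := by
  ext u
  rw [mem_scalarPart, mem_scalarPart, mem_map_conj_iff]
  have h : diagElt u u ∈ Subgroup.center (GL2 ℓ) := diagElt_mem_center_iff.2 rfl
  rw [Subgroup.mem_center_iff.1 h c⁻¹, inv_mul_cancel_right]

end CartanElements

section Hz

variable {ℓ : ℕ}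

theorem diagElt_one_neg_one_mem_Hz (z : (ZMod ℓ)ˣ) : diagElt 1 (-1) ∈ Hz (z : ZMod ℓ) :=
  Subgroup.subset_closure (Or.inr (by simp [mat_diagElt]))

theorem antiElt_one_mem_Hz (z : (ZMod ℓ)ˣ) : antiElt 1 z ∈ Hz (z : ZMod ℓ) :=
  Subgroup.subset_closure (Or.inl (by simp [mat_antiElt]))

theorem Hz_eq_closure (z : (ZMod ℓ)ˣ) :
    Hz (z : ZMod ℓ) = Subgroup.closure {antiElt 1 z, diagElt 1 (-1)} := by
  rw [Hz]
  congr 1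
  ext x
  simp only [Set.mem_ofPred_eq, Set.mem_insert_iff, Set.mem_singleton_iff, ← mat_injective.eq_iff,
    mat_antiElt, mat_diagElt, Units.val_one, Units.val_neg]

theorem diagElt_mem_Hz {z u : (ZMod ℓ)ˣ} (hu : u ∈ Subgroup.zpowers z) :
    diagElt u u ∈ Hz (z : ZMod ℓ) := by
  suffices h : Subgroup.zpowers z ≤ scalarPart (Hz (z : ZMod ℓ)) from mem_scalarPart.1 (h hu)
  rw [Subgroup.zpowers_le, mem_scalarPart]
  have h := mul_mem (antiElt_one_mem_Hz z) (antiElt_one_mem_Hz z)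
  rwa [antiElt_mul_antiElt, one_mul, mul_one] at h

theorem mem_Hz {z : (ZMod ℓ)ˣ} (hz : -1 ∈ Subgroup.zpowers z) {x : GL2 ℓ} :
    x ∈ Hz (z : ZMod ℓ) ↔ ∃ u ∈ Subgroup.zpowers z, x = diagElt u u ∨ x = diagElt u (-u) ∨
      x = antiElt u (u * z) ∨ x = antiElt u (-(u * z)) := by
  have hneg : ∀ u ∈ Subgroup.zpowers z, -u ∈ Subgroup.zpowers z := fun u hu => by
    simpa using mul_mem hz hu
  have hzz := Subgroup.mem_zpowers z
  constructor
  · rw [Hz_eq_closure]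
    intro hx
    induction hx using Subgroup.closure_induction_left with
    | one => exact ⟨1, one_mem _, .inl diagElt_one.symm⟩
    | mul_left a ha y _ ih =>
      obtain ⟨u, hu, ih⟩ := ih
      rcases ha with rfl | rfl
      · rcases ih with rfl | rfl | rfl | rfl
        · exact ⟨u, hu, .inr (.inr (.inl (by simp [antiElt_mul_diagElt, mul_comm])))⟩
        · exact ⟨-u, hneg u hu, .inr (.inr (.inr (by simp [antiElt_mul_diagElt, mul_comm])))⟩
        · exact ⟨u * z, mul_mem hu hzz, .inl (by simp [antiElt_mul_antiElt, mul_comm])⟩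
        · exact ⟨-(u * z), hneg _ (mul_mem hu hzz),
            .inr (.inl (by simp [antiElt_mul_antiElt, mul_comm]))⟩
      · rcases ih with rfl | rfl | rfl | rfl
        · exact ⟨u, hu, .inr (.inl (by simp [diagElt_mul_diagElt]))⟩
        · exact ⟨u, hu, .inl (by simp [diagElt_mul_diagElt])⟩
        · exact ⟨u, hu, .inr (.inr (.inr (by simp [diagElt_mul_antiElt])))⟩
        · exact ⟨u, hu, .inr (.inr (.inl (by simp [diagElt_mul_antiElt])))⟩
    | inv_mul_cancel a ha y _ ih =>
      obtain ⟨u, hu, ih⟩ := ih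
      have hu' := mul_mem hu (inv_mem hzz)
      rcases ha with rfl | rfl
      · rcases ih with rfl | rfl | rfl | rfl
        · exact ⟨u * z⁻¹, hu',
            .inr (.inr (.inl (by simp [antiElt_inv, antiElt_mul_diagElt, mul_comm])))⟩
        · exact ⟨-(u * z⁻¹), hneg _ hu',
            .inr (.inr (.inr (by simp [antiElt_inv, antiElt_mul_diagElt, mul_comm])))⟩
        · exact ⟨u, hu, .inl (by simp [antiElt_inv, antiElt_mul_antiElt, mul_comm])⟩
        · exact ⟨-u, hneg _ hu,
            .inr (.inl (by simp [antiElt_inv, antiElt_mul_antiElt, mul_comm]))⟩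
      · rcases ih with rfl | rfl | rfl | rfl
        · exact ⟨u, hu, .inr (.inl (by simp [diagElt_inv, diagElt_mul_diagElt]))⟩
        · exact ⟨u, hu, .inl (by simp [diagElt_inv, diagElt_mul_diagElt])⟩
        · exact ⟨u, hu, .inr (.inr (.inr (by simp [diagElt_inv, diagElt_mul_antiElt])))⟩
        · exact ⟨u, hu, .inr (.inr (.inl (by simp [diagElt_inv, diagElt_mul_antiElt])))⟩
  · have hA := diagElt_one_neg_one_mem_Hz z
    have hB := antiElt_one_mem_Hz z
    rintro ⟨u, hu, rfl | rfl | rfl | rfl⟩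
    · exact diagElt_mem_Hz hu
    · simpa [diagElt_mul_diagElt] using mul_mem (diagElt_mem_Hz hu) hA
    · simpa [diagElt_mul_antiElt] using mul_mem (diagElt_mem_Hz hu) hB
    · simpa [diagElt_mul_antiElt, diagElt_mul_diagElt] using
        mul_mem (mul_mem (diagElt_mem_Hz hu) hA) hB

theorem ZMod.unit_ne_neg_self [Nontrivial (ZMod ℓ)] (hodd : Odd ℓ) (u : (ZMod ℓ)ˣ) : u ≠ -u :=
  fun h => ZMod.ne_neg_self hodd u.ne_zero (congrArg Units.val h)

theorem scalarPart_Hz [Fact ℓ.Prime] (hodd : Odd ℓ) {z : (ZMod ℓ)ˣ}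
    (hz : -1 ∈ Subgroup.zpowers z) : scalarPart (Hz (z : ZMod ℓ)) = Subgroup.zpowers z := by
  refine le_antisymm (fun u hu => ?_) fun u hu => mem_scalarPart.2 (diagElt_mem_Hz hu)
  obtain ⟨v, hv, h | h | h | h⟩ := (mem_Hz hz).1 (mem_scalarPart.1 hu)
  · rwa [(diagElt_inj.1 h).1]
  · obtain ⟨rfl, h⟩ := diagElt_inj.1 h
    exact absurd h (ZMod.unit_ne_neg_self hodd _)
  · exact absurd h (diagElt_ne_antiElt _ _ _ _)
  · exact absurd h (diagElt_ne_antiElt _ _ _ _)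

end Hz

theorem IsDihedralProj.exists_notMem_center {ℓ : ℕ} {G : Subgroup (GL2 ℓ)} (hG : IsDihedralProj G) :
    ∃ x ∈ G, ∃ y ∈ G, x ∉ Subgroup.center (GL2 ℓ) ∧ y ∉ Subgroup.center (GL2 ℓ) ∧
      x * y ∉ Subgroup.center (GL2 ℓ) := by
  obtain ⟨m, hm, ⟨e⟩⟩ := hG
  have hlift : ∀ t : DihedralGroup m, ∃ x : G, e ⟨_, x, x.2, rfl⟩ = t := by
    intro t
    obtain ⟨⟨_, x, hx, rfl⟩, rfl⟩ := e.surjective t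
    exact ⟨⟨x, hx⟩, rfl⟩
  have hcen : ∀ x : G, (x : GL2 ℓ) ∈ Subgroup.center (GL2 ℓ) →
      e ⟨_, x, x.2, rfl⟩ = 1 := by
    intro x hx
    rw [EmbeddingLike.map_eq_one_iff]
    exact Subtype.ext ((QuotientGroup.eq_one_iff _).2 hx)
  have hmul : ∀ x y : G, e ⟨_, (x * y : G), (x * y).2, rfl⟩ =
      e ⟨_, x, x.2, rfl⟩ * e ⟨_, y, y.2, rfl⟩ := by
    intro x y
    rw [← map_mul]
    rfl
  obtain ⟨x, hx⟩ := hlift (DihedralGroup.r 1)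
  obtain ⟨y, hy⟩ := hlift (DihedralGroup.sr 0)
  have : Fact (1 < m) := ⟨hm⟩
  refine ⟨x, x.2, y, y.2, fun h => ?_, fun h => ?_, fun h => ?_⟩
  · have h := (hcen x h).symm.trans hx
    rw [DihedralGroup.one_def, DihedralGroup.r.injEq] at h
    exact zero_ne_one h
  · have h := (hcen y h).symm.trans hy
    rw [DihedralGroup.one_def] at h
    cases h
  · have h := (hcen (x * y) h).symm.trans (hmul x y)
    rw [hx, hy, DihedralGroup.r_mul_sr, DihedralGroup.one_def] at h
    cases h

section Structure

variable {ℓ : ℕ} [Fact ℓ.Prime]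

theorem trace_diagElt_eq_zero_iff {a b : (ZMod ℓ)ˣ} :
    (mat (diagElt a b)).trace = 0 ↔ b = -a := by
  rw [mat_diagElt, Matrix.trace_fin_two_of, Units.ext_iff, Units.val_neg, add_comm,
    add_eq_zero_iff_eq_neg]

/-- Every element of `G` is scalar or has trace zero. -/
def IsScalarOrTraceless (G : Subgroup (GL2 ℓ)) : Prop :=
  ∀ x ∈ G, x ∈ Subgroup.center (GL2 ℓ) ∨ (mat x).trace = 0

theorem IsScalarOrTraceless.map_conj {G : Subgroup (GL2 ℓ)} (hT : IsScalarOrTraceless G)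
    (c : GL2 ℓ) : IsScalarOrTraceless (G.map (MulAut.conj c).toMonoidHom) := by
  rintro _ ⟨y, hy, rfl⟩
  change c * y * c⁻¹ ∈ _ ∨ (mat (c * y * c⁻¹)).trace = 0
  rw [conj_mem_center_iff, trace_mat_conj]
  exact hT y hy

theorem IsScalarOrTraceless.eq_Hz {G : Subgroup (GL2 ℓ)} (hT : IsScalarOrTraceless G)
    (hC : ∀ x ∈ G, IsCsPlusElt x) {g : (ZMod ℓ)ˣ} (hneg : -1 ∈ Subgroup.zpowers g)
    (hg : Subgroup.zpowers g = scalarPart G) (hA : diagElt 1 (-1) ∈ G) (hB : antiElt 1 g ∈ G) :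
    G = Hz (g : ZMod ℓ) := by
  apply le_antisymm
  · intro x hx
    rw [mem_Hz hneg, hg]
    obtain ⟨a, b, rfl | rfl⟩ := isCsPlusElt_iff.1 (hC x hx)
    · have h := hT _ hx
      rw [diagElt_mem_center_iff, trace_diagElt_eq_zero_iff] at h
      rcases h with rfl | rfl
      · exact ⟨a, mem_scalarPart.2 hx, .inl rfl⟩
      · refine ⟨a, mem_scalarPart.2 ?_, .inr (.inl rfl)⟩
        simpa [diagElt_mul_diagElt] using mul_mem hx hA
    · have hxB := mul_mem hx hB
      rw [antiElt_mul_antiElt, mul_one] at hxB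
      have hgi : g⁻¹ ∈ scalarPart G := hg ▸ inv_mem (Subgroup.mem_zpowers g)
      have h := hT _ hxB
      rw [diagElt_mem_center_iff, trace_diagElt_eq_zero_iff] at h
      rcases h with rfl | rfl
      · refine ⟨a, ?_, .inr (.inr (.inl rfl))⟩
        simpa using mul_mem (mem_scalarPart.2 hxB) hgi
      · refine ⟨a, ?_, .inr (.inr (.inr rfl))⟩
        have h := mul_mem hxB hA
        rw [diagElt_mul_diagElt, neg_mul_neg, mul_one] at h
        simpa using mul_mem (mem_scalarPart.2 h) hgi
  · rw [Hz_eq_closure, Subgroup.closure_le]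
    rintro x (rfl | rfl)
    exacts [hB, hA]

theorem IsScalarOrTraceless.exists_map_conj_eq_Hz (hodd : Odd ℓ) {G : Subgroup (GL2 ℓ)}
    (hT : IsScalarOrTraceless G) (hC : ∀ x ∈ G, IsCsPlusElt x) {s b c g : (ZMod ℓ)ˣ}
    (hA : diagElt s (-s) ∈ G) (hB : antiElt b c ∈ G) (hbc : ¬ IsSquare (b * c))
    (hg : Subgroup.zpowers g = scalarPart G) :
    ∃ d : GL2 ℓ, G.map (MulAut.conj d).toMonoidHom = Hz (g : ZMod ℓ) := by
  have hn : b * c ∈ scalarPart G := by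
    rw [mem_scalarPart]
    simpa [antiElt_mul_antiElt, mul_comm] using mul_mem hB hB
  have hs : s ∈ scalarPart G := by
    refine Subgroup.mem_of_sq_mem_of_not_isSquare hodd hbc hn ?_
    rw [mem_scalarPart]
    simpa [diagElt_mul_diagElt, sq] using mul_mem hA hA
  obtain ⟨w, hw, hwg⟩ := Subgroup.exists_sq_mul_eq_of_zpowers_eq hodd hg hbc hn
  have hA' : diagElt 1 (-1) ∈ G := by
    simpa [diagElt_mul_diagElt, diagElt_inv] using
      mul_mem (inv_mem (mem_scalarPart.1 hs)) hA
  have hB' : antiElt (w * b) (w * c) ∈ G := by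
    simpa [diagElt_mul_antiElt] using mul_mem (mem_scalarPart.1 hw) hB
  have hg' : ¬ IsSquare g := ZMod.not_isSquare_of_mem_zpowers hbc (hg ▸ hn)
  refine ⟨diagElt (w * b)⁻¹ 1, (hT.map_conj _).eq_Hz ?_
    (ZMod.neg_one_mem_zpowers_of_not_isSquare hodd hg') ?_ ?_ ?_⟩
  · rintro _ ⟨y, hy, rfl⟩
    obtain ⟨p, q, rfl | rfl⟩ := isCsPlusElt_iff.1 (hC y hy) <;> rw [isCsPlusElt_iff]
    · exact ⟨_, _, .inl (by simp [diagElt_mul_diagElt, diagElt_inv]; rfl)⟩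
    · exact ⟨_, _, .inr (by simp [diagElt_mul_antiElt, antiElt_mul_diagElt, diagElt_inv]; rfl)⟩
  · rw [hg, scalarPart_map_conj]
  · rw [mem_map_conj_iff]
    simpa [diagElt_mul_diagElt, diagElt_inv] using hA'
  · rw [mem_map_conj_iff]
    have h : (diagElt (w * b)⁻¹ 1)⁻¹ * antiElt 1 g * diagElt (w * b)⁻¹ 1 =
        antiElt (w * b) (w * c) := by
      rw [diagElt_inv, diagElt_mul_antiElt, antiElt_mul_diagElt, ← hwg]
      congr 1
      · simp
      · rw [inv_one, one_mul, mul_inv_eq_iff_eq_mul, sq]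
        ac_rfl
    rwa [h]

theorem exists_zpowers_eq_scalarPart (G : Subgroup (GL2 ℓ)) :
    ∃ g, Subgroup.zpowers g = scalarPart G :=
  (Subgroup.isCyclic_iff_exists_zpowers_eq_top _).1 inferInstance

/-- Discriminants separate the two Cartan subgroups. -/
theorem isScalarOrTraceless_of_conj {ε : ZMod ℓ} (hε : ¬ IsSquare ε) {G : Subgroup (GL2 ℓ)}
    {c d : GL2 ℓ} (hc : ∀ x ∈ G, IsCsPlusElt (c * x * c⁻¹))
    (hd : ∀ x ∈ G, IsNSPlusElt ε (d * x * d⁻¹)) : IsScalarOrTraceless G := by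
  intro x hx
  rcases hc x hx with h | ⟨h1, h2⟩
  · rcases hd x hx with ⟨h3, h4⟩ | ⟨h3, h4⟩
    · left
      have ht : (mat (c * x * c⁻¹)).trace = (mat (d * x * d⁻¹)).trace := by
        rw [trace_mat_conj, trace_mat_conj]
      have hdet : (mat (c * x * c⁻¹)).det = (mat (d * x * d⁻¹)).det := by
        rw [det_mat_conj, det_mat_conj]
      obtain ⟨a, b, hab⟩ := h.exists_eq_diagElt
      rw [← conj_mem_center_iff (c := c), hab, diagElt_mem_center_iff]
      rw [hab, mat_diagElt, Matrix.trace_fin_two_of, Matrix.trace_fin_two, h3] at ht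
      rw [hab, mat_diagElt, Matrix.det_fin_two_of, Matrix.det_fin_two, h3, h4] at hdet
      by_contra hne
      generalize mat (d * x * d⁻¹) 0 0 = p at *
      generalize mat (d * x * d⁻¹) 1 0 = q at *
      have key : ((a : ZMod ℓ) - b) ^ 2 = ε * (2 * q) ^ 2 := by
        linear_combination (a + b + 2 * p : ZMod ℓ) * ht - 4 * hdet
      have hq : 2 * q ≠ 0 := by
        intro h0
        rw [h0, sq (0 : ZMod ℓ), mul_zero, mul_zero, sq_eq_zero_iff, sub_eq_zero] at key
        exact hne (Units.ext key)
      refine hε ⟨((a : ZMod ℓ) - b) / (2 * q), ?_⟩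
      rw [div_mul_div_comm, eq_div_iff (mul_ne_zero hq hq)]
      linear_combination -key
    · right
      rw [← trace_mat_conj d, Matrix.trace_fin_two, h3, add_neg_cancel]
  · right
    rw [← trace_mat_conj c, Matrix.trace_fin_two, h1, h2, add_zero]

theorem sq_mem_center_of_trace_eq_zero {x : GL2 ℓ} (hx : (mat x).trace = 0) :
    x ^ 2 ∈ Subgroup.center (GL2 ℓ) := by
  rw [GeneralLinearGroup.mem_center_iff_val_mem_range_scalar]
  refine ⟨-(mat x).det, ?_⟩
  have h : (x ^ 2).val = mat x * mat x := by rw [sq]; rfl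
  rw [Matrix.trace_fin_two] at hx
  have h11 : mat x 1 1 = - mat x 0 0 := by linear_combination hx
  rw [h, Matrix.det_fin_two]
  ext i j
  fin_cases i <;> fin_cases j <;> simp [Matrix.mul_apply, Fin.sum_univ_two, h11] <;> ring

theorem IsScalarOrTraceless.sq_mem_center {G : Subgroup (GL2 ℓ)} (hT : IsScalarOrTraceless G)
    {x : GL2 ℓ} (hx : x ∈ G) : x ^ 2 ∈ Subgroup.center (GL2 ℓ) :=
  (hT x hx).elim (fun h => pow_mem h 2) sq_mem_center_of_trace_eq_zero

theorem IsScalarOrTraceless.sq_eq_one {G : Subgroup (GL2 ℓ)} (hT : IsScalarOrTraceless G)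
    (y : projImage G) : y ^ 2 = 1 := by
  obtain ⟨_, x, hx, rfl⟩ := y
  refine Subtype.ext ?_
  change (QuotientGroup.mk' _ x) ^ 2 = 1
  rw [← map_pow]
  exact (QuotientGroup.eq_one_iff _).2 (hT.sq_mem_center hx)

theorem IsScalarOrTraceless.nonempty_mulEquiv {G : Subgroup (GL2 ℓ)}
    (hT : IsScalarOrTraceless G) (hG : IsDihedralProj G) :
    Nonempty (projImage G ≃* DihedralGroup 2) := by
  obtain ⟨m, hm, ⟨e⟩⟩ := hG
  have h : (DihedralGroup.r 1 : DihedralGroup m) ^ 2 = 1 := by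
    rw [← e.apply_symm_apply (DihedralGroup.r 1), ← map_pow, hT.sq_eq_one, map_one]
  rw [← orderOf_dvd_iff_pow_eq_one, DihedralGroup.orderOf_r_one] at h
  obtain rfl : m = 2 := le_antisymm (Nat.le_of_dvd two_pos h) hm
  exact ⟨e⟩

theorem IsDihedralProj.exists_map_conj_eq_Hz (hodd : Odd ℓ) {ε : ZMod ℓ} (hε : ¬ IsSquare ε)
    {G : Subgroup (GL2 ℓ)} (hG : IsDihedralProj G)
    (hcs : ∃ c : GL2 ℓ, ∀ x ∈ G, IsCsPlusElt (c * x * c⁻¹))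
    (hns : ∃ c : GL2 ℓ, ∀ x ∈ G, IsNSPlusElt ε (c * x * c⁻¹)) {g : (ZMod ℓ)ˣ}
    (hg : Subgroup.zpowers g = scalarPart G) :
    ¬ IsSquare g ∧ ∃ d : GL2 ℓ, G.map (MulAut.conj d).toMonoidHom = Hz (g : ZMod ℓ) := by
  obtain ⟨c, hc⟩ := hcs
  obtain ⟨d, hd⟩ := hns
  have hT := isScalarOrTraceless_of_conj hε hc hd
  obtain ⟨x, hx, y, hy, hxc, hyc, hxyc⟩ := hG.exists_notMem_center
  -- a non-scalar diagonal element in the split frame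
  have hA : ∃ s, diagElt s (-s) ∈ G.map (MulAut.conj c).toMonoidHom := by
    have key : ∀ w ∈ G, w ∉ Subgroup.center (GL2 ℓ) → IsDiagElt (c * w * c⁻¹) →
        ∃ s, diagElt s (-s) ∈ G.map (MulAut.conj c).toMonoidHom := by
      intro w hw hwc hwd
      obtain ⟨a, b, hab⟩ := hwd.exists_eq_diagElt
      have ht := (hT w hw).resolve_left hwc
      rw [← trace_mat_conj c, hab, trace_diagElt_eq_zero_iff] at ht
      exact ⟨a, w, hw, by rw [← ht, ← hab]; rfl⟩
    rcases hc x hx with h | h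
    · exact key x hx hxc h
    rcases hc y hy with h' | h'
    · exact key y hy hyc h'
    obtain ⟨a, b, hab⟩ := h.exists_eq_antiElt
    obtain ⟨a', b', hab'⟩ := h'.exists_eq_antiElt
    refine key _ (mul_mem hx hy) hxyc ?_
    have : c * (x * y) * c⁻¹ = diagElt (a * b') (b * a') := by
      rw [← antiElt_mul_antiElt, ← hab, ← hab']
      group
    rw [this]
    exact ⟨rfl, rfl⟩
  -- an element of trace zero with `-det` a non-square
  have hB : ∃ w ∈ G, w ∉ Subgroup.center (GL2 ℓ) ∧ ¬ IsSquare (-(mat w).det) := by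
    have key : ∀ w ∈ G, w ∉ Subgroup.center (GL2 ℓ) → IsNSElt ε (d * w * d⁻¹) →
        ∃ w ∈ G, w ∉ Subgroup.center (GL2 ℓ) ∧ ¬ IsSquare (-(mat w).det) := by
      rintro w hw hwc ⟨h1, h2⟩
      refine ⟨w, hw, hwc, ?_⟩
      have ht := (hT w hw).resolve_left hwc
      have h0 := det_mat_ne_zero (d * w * d⁻¹)
      rw [← trace_mat_conj d, Matrix.trace_fin_two, h1, ← two_mul] at ht
      have h2' : (2 : ZMod ℓ) ≠ 0 := by
        intro h
        exact ZMod.ne_neg_self hodd (one_ne_zero (α := ZMod ℓ)) (by linear_combination h)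
      have hp := (mul_eq_zero.1 ht).resolve_left h2'
      rw [← det_mat_conj d]
      rw [Matrix.det_fin_two, h1, h2, hp] at h0 ⊢
      generalize mat (d * w * d⁻¹) 1 0 = q at *
      have hq : q ≠ 0 := by
        rintro rfl
        simp at h0
      rintro ⟨r, hr⟩
      refine hε ⟨r / q, ?_⟩
      rw [div_mul_div_comm, eq_div_iff (mul_ne_zero hq hq)]
      linear_combination hr
    rcases hd x hx with h | ⟨h1, h2⟩
    · exact key x hx hxc h
    rcases hd y hy with h' | ⟨h1', h2'⟩
    · exact key y hy hyc h'
    refine key _ (mul_mem hx hy) hxyc ?_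
    have : d * (x * y) * d⁻¹ = (d * x * d⁻¹) * (d * y * d⁻¹) := by group
    rw [this, IsNSElt, mat_mul]
    simp only [Matrix.mul_apply, Fin.sum_univ_two, h1, h2, h1', h2']
    constructor <;> ring
  obtain ⟨s, hs⟩ := hA
  obtain ⟨w, hw, hwc, hwn⟩ := hB
  have hB : ∃ a b, antiElt a b ∈ G.map (MulAut.conj c).toMonoidHom ∧ ¬ IsSquare (a * b) := by
    rw [← det_mat_conj c] at hwn
    obtain ⟨a, b, hab⟩ := isCsPlusElt_iff.1 (hc w hw)
    have ht := (hT w hw).resolve_left hwc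
    rw [← trace_mat_conj c] at ht
    rcases hab with hab | hab
    · rw [hab, trace_diagElt_eq_zero_iff] at ht
      rw [hab, ht, mat_diagElt, Matrix.det_fin_two_of] at hwn
      exact absurd ⟨(a : ZMod ℓ), by simp⟩ hwn
    · rw [hab, mat_antiElt, Matrix.det_fin_two_of] at hwn
      refine ⟨a, b, ⟨w, hw, hab⟩, ZMod.not_isSquare_val_units.1 ?_⟩
      simpa using hwn
  obtain ⟨a, b, hab, habn⟩ := hB
  rw [← scalarPart_map_conj c] at hg
  have hmem : a * b ∈ scalarPart (G.map (MulAut.conj c).toMonoidHom) := by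
    rw [mem_scalarPart]
    simpa [antiElt_mul_antiElt, mul_comm] using mul_mem hab hab
  refine ⟨ZMod.not_isSquare_of_mem_zpowers habn (hg ▸ hmem), ?_⟩
  obtain ⟨t, ht⟩ := (hT.map_conj c).exists_map_conj_eq_Hz hodd
    (by rintro _ ⟨y, hy, rfl⟩; exact hc y hy) hs hab habn hg
  exact ⟨t * c, by rw [← map_conj_map_conj, ht]⟩

end Structure

section HzProperties

variable {ℓ : ℕ} [Fact ℓ.Prime]

theorem isCsPlusElt_of_mem_Hz {z : (ZMod ℓ)ˣ} (hz : -1 ∈ Subgroup.zpowers z) {x : GL2 ℓ}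
    (hx : x ∈ Hz (z : ZMod ℓ)) : IsCsPlusElt x := by
  rw [isCsPlusElt_iff]
  obtain ⟨u, -, h | h | h | h⟩ := (mem_Hz hz).1 hx
  exacts [⟨_, _, .inl h⟩, ⟨_, _, .inl h⟩, ⟨_, _, .inr h⟩, ⟨_, _, .inr h⟩]

theorem exists_isNSPlusElt_conj_Hz (hodd : Odd ℓ) {ε : ZMod ℓ} (hε : ¬ IsSquare ε)
    {z : (ZMod ℓ)ˣ} (hz : ¬ IsSquare z) :
    ∃ c : GL2 ℓ, ∀ x ∈ Hz (z : ZMod ℓ), IsNSPlusElt ε (c * x * c⁻¹) := by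
  have hε0 : ε ≠ 0 := by
    rintro rfl
    exact hε ⟨0, by simp⟩
  lift ε to (ZMod ℓ)ˣ using hε0.isUnit
  obtain ⟨a, ha⟩ := ZMod.isSquare_units_mul_of_not_isSquare hodd
    (ZMod.not_isSquare_val_units.1 hε) hz
  have ha' : (a : ZMod ℓ) = ε * (z * (a⁻¹ : (ZMod ℓ)ˣ)) := by
    rw [← Units.val_mul, ← Units.val_mul, ← mul_assoc, ha, mul_inv_cancel_right]
  refine ⟨diagElt a 1, fun x hx => ?_⟩
  obtain ⟨u, -, rfl | rfl | rfl | rfl⟩ :=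
    (mem_Hz (ZMod.neg_one_mem_zpowers_of_not_isSquare hodd hz)).1 hx
  · rw [diagElt_mul_diagElt, diagElt_inv, diagElt_mul_diagElt]
    exact .inl ⟨by simp [mat_diagElt], by simp [mat_diagElt]⟩
  · rw [diagElt_mul_diagElt, diagElt_inv, diagElt_mul_diagElt]
    exact .inr ⟨by simp [mat_diagElt], by simp [mat_diagElt]⟩
  · rw [diagElt_mul_antiElt, diagElt_inv, antiElt_mul_diagElt]
    refine .inl ⟨rfl, ?_⟩
    simp only [mat_antiElt, Matrix.of_apply, Matrix.cons_val, Units.val_mul, inv_one, Units.val_one]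
    linear_combination (u : ZMod ℓ) * ha'
  · rw [diagElt_mul_antiElt, diagElt_inv, antiElt_mul_diagElt]
    refine .inr ⟨neg_zero.symm, ?_⟩
    simp only [mat_antiElt, Matrix.of_apply, Matrix.cons_val, Units.val_mul, Units.val_neg,
      inv_one, Units.val_one]
    linear_combination (u : ZMod ℓ) * ha'

theorem isScalarOrTraceless_Hz {z : (ZMod ℓ)ˣ} (hz : -1 ∈ Subgroup.zpowers z) :
    IsScalarOrTraceless (Hz (z : ZMod ℓ)) := by
  intro x hx
  obtain ⟨u, -, rfl | rfl | rfl | rfl⟩ := (mem_Hz hz).1 hx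
  · exact .inl (diagElt_mem_center_iff.2 rfl)
  all_goals right; simp [mat_diagElt, mat_antiElt, Matrix.trace_fin_two_of]

theorem card_projImage_Hz (hodd : Odd ℓ) {z : (ZMod ℓ)ˣ} (hz : -1 ∈ Subgroup.zpowers z) :
    Nat.card (projImage (Hz (z : ZMod ℓ))) = 4 := by
  let π : GL2 ℓ → GL2 ℓ ⧸ Subgroup.center (GL2 ℓ) := QuotientGroup.mk
  have hset : (projImage (Hz (z : ZMod ℓ)) : Set (GL2 ℓ ⧸ Subgroup.center (GL2 ℓ))) =
      {π (diagElt 1 1), π (diagElt 1 (-1)), π (antiElt 1 z), π (antiElt 1 (-z))} := by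
    have hπ : ∀ u x, π (diagElt u u * x) = π x := by
      intro u x
      change QuotientGroup.mk _ = QuotientGroup.mk _
      rw [QuotientGroup.mk_mul,
        (QuotientGroup.eq_one_iff _).2 (diagElt_mem_center_iff.2 rfl), one_mul]
    ext y
    constructor
    · rintro ⟨x, hx, rfl⟩
      change π x ∈ _
      obtain ⟨u, -, rfl | rfl | rfl | rfl⟩ := (mem_Hz hz).1 hx
      · left; rw [← hπ u (diagElt 1 1)]; simp [diagElt_mul_diagElt]
      · right; left; rw [← hπ u (diagElt 1 (-1))]; simp [diagElt_mul_diagElt]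
      · right; right; left; rw [← hπ u (antiElt 1 z)]; simp [diagElt_mul_antiElt]
      · right; right; right
        rw [Set.mem_singleton_iff, ← hπ u (antiElt 1 (-z))]; simp [diagElt_mul_antiElt]
    · have h1 := one_mem (Subgroup.zpowers z)
      rintro (rfl | rfl | rfl | rfl)
      · exact ⟨_, (mem_Hz hz).2 ⟨1, h1, .inl rfl⟩, rfl⟩
      · exact ⟨_, (mem_Hz hz).2 ⟨1, h1, .inr (.inl rfl)⟩, rfl⟩
      · exact ⟨_, (mem_Hz hz).2 ⟨1, h1, .inr (.inr (.inl (by rw [one_mul])))⟩, rfl⟩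
      · exact ⟨_, (mem_Hz hz).2 ⟨1, h1, .inr (.inr (.inr (by rw [one_mul])))⟩, rfl⟩
  have hne : ∀ x y : GL2 ℓ, x⁻¹ * y ∉ Subgroup.center (GL2 ℓ) → π x ≠ π y :=
    fun x y h h' => h (QuotientGroup.eq.1 h')
  have h1 := ZMod.unit_ne_neg_self hodd (1 : (ZMod ℓ)ˣ)
  have h01 : π (diagElt 1 1) ≠ π (diagElt 1 (-1)) := hne _ _ (by
    simpa [diagElt_inv, diagElt_mul_diagElt, diagElt_mem_center_iff] using h1)
  have h02 : ∀ a b c d, π (diagElt a b) ≠ π (antiElt c d) := fun a b c d => hne _ _ (by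
    rw [diagElt_inv, diagElt_mul_antiElt]
    exact antiElt_notMem_center _ _)
  have h23 : π (antiElt 1 z) ≠ π (antiElt 1 (-z)) := hne _ _ (by
    simpa [antiElt_inv, antiElt_mul_antiElt, diagElt_mem_center_iff] using h1.symm)
  rw [← SetLike.coe_sort_coe, Nat.card_coe_set_eq, hset, Set.ncard_insert_of_notMem,
    Set.ncard_insert_of_notMem, Set.ncard_pair h23]
  · simp [h02]
  · simp [h02, h01]

theorem isDihedralProj_Hz (hodd : Odd ℓ) {z : (ZMod ℓ)ˣ} (hz : -1 ∈ Subgroup.zpowers z) :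
    IsDihedralProj (Hz (z : ZMod ℓ)) := by
  have hcard := card_projImage_Hz hodd hz
  have : Nontrivial (projImage (Hz (z : ZMod ℓ))) :=
    have := Nat.finite_of_card_ne_zero (hcard.trans_ne four_ne_zero)
    Finite.one_lt_card_iff_nontrivial.1 (by omega)
  have : IsKleinFour (projImage (Hz (z : ZMod ℓ))) :=
    { card_four := hcard
      exponent_two := (Monoid.exponent_eq_prime_iff Nat.prime_two).2 fun g hg =>
        orderOf_eq_prime ((isScalarOrTraceless_Hz hz).sq_eq_one g) hg }
  exact ⟨2, le_rfl, IsKleinFour.nonempty_mulEquiv⟩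

end HzProperties

theorem conjClassCount_eq_ncard_range_comp {G : Type*} [Group G] {P : Subgroup G → Prop}
    (f : Subgroup G → ℕ)
    (hf : ∀ H K, P H → P K →
      (f H = f K ↔ ∃ c : G, H.map (MulAut.conj c).toMonoidHom = K)) :
    conjClassCount P = (f '' {H | P H}).ncard := by
  let F : Quotient (Setoid.comap (Subtype.val : {H : Subgroup G // P H} → Subgroup G)
      (MulAction.orbitRel (ConjAct G) (Subgroup G))) → ℕ :=
    Quotient.lift (fun H => f H.1) (by
      rintro H K ⟨c, hc⟩
      exact ((hf K H K.2 H.2).2 ⟨ConjAct.ofConjAct c, hc⟩).symm)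
  have hF : Function.Injective F := by
    intro a b
    refine Quotient.inductionOn₂ a b fun H K hHK => Quotient.sound ?_
    obtain ⟨c, hc⟩ := (hf K H K.2 H.2).1 (Eq.symm hHK)
    exact ⟨ConjAct.toConjAct c, hc⟩
  rw [conjClassCount, ← Nat.card_range_of_injective hF, Nat.card_coe_set_eq]
  congr 1
  ext n
  constructor
  · rintro ⟨a, rfl⟩
    induction a using Quotient.inductionOn with
    | h H => exact ⟨H.1, H.2, rfl⟩
  · rintro ⟨H, hH, rfl⟩
    exact ⟨Quotient.mk _ ⟨H, hH⟩, rfl⟩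

/-- Let `ℓ` be an odd prime and `G ⊆ GL₂(ℤ/ℓℤ)` a subgroup with dihedral projective
image.  Then `G` is conjugate both to a subgroup of `C_s⁺(ℓ)` and to a subgroup of
`C_ns⁺(ℓ)` iff `G` is conjugate to `H_z = ⟨[[0,1],[z,0]], [[1,0],[0,−1]]⟩` for some
non-square `z ∈ (ℤ/ℓℤ)ˣ`, in which case the image of `G` in `PGL₂(ℤ/ℓℤ)` is the Klein
four-group of order 4.  Moreover, the number of conjugacy classes of such subgroups
equals the number of odd positive divisors of `ℓ − 1`. -/
theorem stmt11 (ℓ : ℕ) [Fact (Nat.Prime ℓ)] (hodd : Odd ℓ)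
    (ε : ZMod ℓ) (hε : ¬ IsSquare ε) :
    (∀ G : Subgroup (GL2 ℓ), IsDihedralProj G →
      (((∃ c : GL2 ℓ, ∀ x ∈ G, IsCsPlusElt (c * x * c⁻¹)) ∧
        (∃ c : GL2 ℓ, ∀ x ∈ G, IsNSPlusElt ε (c * x * c⁻¹))) ↔
       (∃ z : ZMod ℓ, ¬ IsSquare z ∧
        ∃ c : GL2 ℓ, Subgroup.map (MulAut.conj c).toMonoidHom G = Hz z))) ∧
    (∀ G : Subgroup (GL2 ℓ), IsDihedralProj G →
      (∃ c : GL2 ℓ, ∀ x ∈ G, IsCsPlusElt (c * x * c⁻¹)) →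
      (∃ c : GL2 ℓ, ∀ x ∈ G, IsNSPlusElt ε (c * x * c⁻¹)) →
      Nonempty (↥(projImage G) ≃* DihedralGroup 2)) ∧
    conjClassCount (fun G : Subgroup (GL2 ℓ) =>
        IsDihedralProj G ∧
        (∃ c : GL2 ℓ, ∀ x ∈ G, IsCsPlusElt (c * x * c⁻¹)) ∧
        (∃ c : GL2 ℓ, ∀ x ∈ G, IsNSPlusElt ε (c * x * c⁻¹))) =
      ((ℓ - 1).divisors.filter fun d => Odd d).card := by
  have hHz : ∀ z : (ZMod ℓ)ˣ, ¬ IsSquare z → ∀ (G : Subgroup (GL2 ℓ)) (c : GL2 ℓ),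
      G.map (MulAut.conj c).toMonoidHom = Hz (z : ZMod ℓ) →
      (∃ c : GL2 ℓ, ∀ x ∈ G, IsCsPlusElt (c * x * c⁻¹)) ∧
        (∃ c : GL2 ℓ, ∀ x ∈ G, IsNSPlusElt ε (c * x * c⁻¹)) := by
    intro z hz G c hc
    have hmem : ∀ x ∈ G, c * x * c⁻¹ ∈ Hz (z : ZMod ℓ) := fun x hx => hc ▸ ⟨x, hx, rfl⟩
    obtain ⟨d, hd⟩ := exists_isNSPlusElt_conj_Hz hodd hε hz
    refine ⟨⟨c, fun x hx => isCsPlusElt_of_mem_Hz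
      (ZMod.neg_one_mem_zpowers_of_not_isSquare hodd hz) (hmem x hx)⟩,
      ⟨d * c, fun x hx => ?_⟩⟩
    simpa [mul_assoc] using hd _ (hmem x hx)
  refine ⟨fun G hG => ⟨fun ⟨hcs, hns⟩ => ?_, fun ⟨z, hz, c, hc⟩ => ?_⟩, fun G hG hcs hns => ?_, ?_⟩
  · obtain ⟨g, hg⟩ := exists_zpowers_eq_scalarPart G
    obtain ⟨hgs, hd⟩ := hG.exists_map_conj_eq_Hz hodd hε hcs hns hg
    exact ⟨g, ZMod.not_isSquare_val_units.2 hgs, hd⟩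
  · have hz0 : z ≠ 0 := by
      rintro rfl
      exact hz ⟨0, by simp⟩
    lift z to (ZMod ℓ)ˣ using hz0.isUnit
    exact hHz z (ZMod.not_isSquare_val_units.1 hz) G c hc
  · obtain ⟨c, hc⟩ := hcs
    obtain ⟨d, hd⟩ := hns
    exact (isScalarOrTraceless_of_conj hε hc hd).nonempty_mulEquiv hG
  · rw [conjClassCount_eq_ncard_range_comp (fun G => (scalarPart G).index),
      ← Set.ncard_coe_finset]
    · congr 1
      ext n
      simp only [Set.mem_image, Set.mem_ofPred_eq, Finset.coe_filter, Nat.mem_divisors]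
      constructor
      · rintro ⟨G, ⟨hG, hcs, hns⟩, rfl⟩
        obtain ⟨g, hg⟩ := exists_zpowers_eq_scalarPart G
        obtain ⟨hgs, -⟩ := hG.exists_map_conj_eq_Hz hodd hε hcs hns hg
        refine ⟨⟨?_, (Nat.sub_pos_of_lt (Fact.out : ℓ.Prime).one_lt).ne'⟩,
          Subgroup.odd_index_of_not_isSquare_mem hodd hgs (hg ▸ Subgroup.mem_zpowers g)⟩
        have h := (scalarPart G).index_dvd_card
        rwa [Nat.card_eq_fintype_card, ZMod.card_units] at h
      · rintro ⟨⟨hn, -⟩, hno⟩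
        obtain ⟨z, hz, hzi⟩ := ZMod.exists_not_isSquare_index_zpowers hodd hno hn
        have hz' := ZMod.neg_one_mem_zpowers_of_not_isSquare hodd hz
        refine ⟨Hz (z : ZMod ℓ), ⟨isDihedralProj_Hz hodd hz', hHz z hz _ 1 ?_⟩, ?_⟩
        · ext x
          simp
        · rw [scalarPart_Hz hodd hz', hzi]
    · rintro G K ⟨hG, hGc, hGn⟩ ⟨hK, hKc, hKn⟩
      constructor
      · intro h
        have h := Subgroup.eq_of_index_eq_of_isCyclic h
        obtain ⟨g, hg⟩ := exists_zpowers_eq_scalarPart G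
        obtain ⟨-, c, hc⟩ := hG.exists_map_conj_eq_Hz hodd hε hGc hGn hg
        obtain ⟨-, d, hd⟩ := hK.exists_map_conj_eq_Hz hodd hε hKc hKn (hg.trans h)
        refine ⟨d⁻¹ * c, ?_⟩
        rw [← map_conj_map_conj, hc, ← hd, map_conj_map_conj]
        ext x
        simp
      · rintro ⟨c, rfl⟩
        simp only [scalarPart_map_conj]
end

section
/- Let ℓ ≥ 5 be prime and let H₀ be one of the groups A₄ (alternating group on 4 letters), S₄ (symmetric group on 4 letters), or A₅ (alternating group on 5 letters). Suppose G and G' are subgroups of GL₂(ℤ/ℓℤ) whose images in PGL₂(ℓ) are both isomorphic to H₀, whose scalar subgroups coincide and contain −1 (i.e., G ∩ Z(ℓ) = G' ∩ Z(ℓ) ∋ −1), and whose determinant images coincide (det(G) = det(G') as subgroups of (ℤ/ℓℤ)ˣ). Then G and G' are conjugate in GL₂(ℓ). -/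
open Matrix

/-- Membership in the scalar subgroup `Z(ℓ)`. -/
def IsScalarElt {ℓ : ℕ} (g : GL2 ℓ) : Prop :=
  mat g 0 1 = 0 ∧ mat g 1 0 = 0 ∧ mat g 0 0 = mat g 1 1

/-- The set of determinants of the elements of a subgroup of `GL₂(ℤ/ℓℤ)`. -/
def detSet {ℓ : ℕ} (H : Subgroup (GL2 ℓ)) : Set (ZMod ℓ) :=
  {d | ∃ g ∈ H, (mat g).det = d}

section Quaternions

variable {F : Type*} [Field F]

/-- The matrix `a + b i + c j + d k`, where `i = !![0, -1; 1, 0]`, `j = !![x, y; y, -x]` and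
`k = i j`; these satisfy the quaternion relations as soon as `x ^ 2 + y ^ 2 = -1`. -/
def quat (x y a b c d : F) : Matrix (Fin 2) (Fin 2) F :=
  !![a + c * x - d * y, -b + c * y + d * x; b + c * y + d * x, a - c * x + d * y]

lemma quat_mul {x y : F} (h : x ^ 2 + y ^ 2 = -1) (a b c d a' b' c' d' : F) :
    quat x y a b c d * quat x y a' b' c' d' =
      quat x y (a * a' - b * b' - c * c' - d * d') (a * b' + b * a' + c * d' - d * c')
        (a * c' - b * d' + c * a' + d * b') (a * d' + b * c' - c * b' + d * a') := by
  simp only [quat, Matrix.mul_fin_two]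
  ext i j
  fin_cases i <;> fin_cases j <;> simp
  · linear_combination (c * c' + d * d') * h
  · linear_combination (c * d' - d * c') * h
  · linear_combination (d * c' - c * d') * h
  · linear_combination (c * c' + d * d') * h

lemma quat_det {x y : F} (h : x ^ 2 + y ^ 2 = -1) (a b c d : F) :
    (quat x y a b c d).det = a ^ 2 + b ^ 2 + c ^ 2 + d ^ 2 := by
  simp only [quat, Matrix.det_fin_two_of]
  linear_combination -(c ^ 2 + d ^ 2) * h

lemma quat_trace (x y a b c d : F) : (quat x y a b c d).trace = 2 * a := by
  simp only [quat, Matrix.trace_fin_two_of]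
  ring

lemma smul_quat (x y s a b c d : F) :
    s • quat x y a b c d = quat x y (s * a) (s * b) (s * c) (s * d) := by
  ext i j
  fin_cases i <;> fin_cases j <;> simp [quat] <;> ring

lemma quat_neg (x y a b c d : F) : -quat x y a b c d = quat x y (-a) (-b) (-c) (-d) := by
  rw [← neg_one_smul F, smul_quat]
  simp

lemma quat_inj (h2 : (2 : F) ≠ 0) {x y : F} (h : x ^ 2 + y ^ 2 = -1) {a b c d a' b' c' d' : F}
    (e : quat x y a b c d = quat x y a' b' c' d') : a = a' ∧ b = b' ∧ c = c' ∧ d = d' := by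
  have e00 := congrFun₂ e 0 0
  have e01 := congrFun₂ e 0 1
  have e10 := congrFun₂ e 1 0
  have e11 := congrFun₂ e 1 1
  simp only [quat, Matrix.of_apply, Matrix.cons_val', Matrix.cons_val_zero, Matrix.cons_val_one,
    Matrix.cons_val_fin_one] at e00 e01 e10 e11
  refine ⟨?_, ?_, ?_, ?_⟩ <;> apply mul_left_cancel₀ h2
  · linear_combination e00 + e11
  · linear_combination e10 - e01
  · linear_combination 2 * (c - c') * h - x * (e00 - e11) - y * (e01 + e10)
  · linear_combination 2 * (d - d') * h + y * (e00 - e11) - x * (e01 + e10)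

lemma exists_eq_quat (h2 : (2 : F) ≠ 0) {x y : F} (h : x ^ 2 + y ^ 2 = -1)
    (M : Matrix (Fin 2) (Fin 2) F) : ∃ a b c d, M = quat x y a b c d := by
  refine ⟨(M 0 0 + M 1 1) / 2, (M 1 0 - M 0 1) / 2,
    -(x * (M 0 0 - M 1 1) + y * (M 0 1 + M 1 0)) / 2,
    (y * (M 0 0 - M 1 1) - x * (M 0 1 + M 1 0)) / 2, ?_⟩
  ext i j
  fin_cases i <;> fin_cases j <;> simp [quat] <;> field_simp
  · linear_combination (M 0 0 - M 1 1) * h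
  · linear_combination (M 0 1 + M 1 0) * h
  · linear_combination (M 0 1 + M 1 0) * h
  · linear_combination -(M 0 0 - M 1 1) * h

lemma mem_center_iff_entries {g : GL (Fin 2) F} : g ∈ Subgroup.center (GL (Fin 2) F) ↔
    g.val 0 1 = 0 ∧ g.val 1 0 = 0 ∧ g.val 0 0 = g.val 1 1 := by
  rw [Matrix.GeneralLinearGroup.mem_center_iff_val_mem_range_scalar]
  constructor
  · rintro ⟨a, ha⟩
    simp [← ha]
  · rintro ⟨h1, h2, h3⟩
    refine ⟨g.val 0 0, ?_⟩
    ext i j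
    fin_cases i <;> fin_cases j <;> simp [h1, h2, h3]

lemma trace_eq_zero_of_sq_mem_center {g : GL (Fin 2) F}
    (hg : g ∉ Subgroup.center (GL (Fin 2) F)) (h : g ^ 2 ∈ Subgroup.center (GL (Fin 2) F)) :
    g.val.trace = 0 := by
  contrapose! hg
  rw [mem_center_iff_entries] at h ⊢
  simp only [pow_succ, pow_zero, one_mul, Units.val_mul, Matrix.mul_apply,
    Fin.sum_univ_two] at h
  rw [Matrix.trace_fin_two] at hg
  obtain ⟨h1, h2, h3⟩ := h
  refine ⟨?_, ?_, ?_⟩ <;> apply mul_left_cancel₀ hg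
  · linear_combination h1
  · linear_combination h2
  · linear_combination h3

lemma trace_sq_eq_det_of_pow_three_mem_center {g : GL (Fin 2) F}
    (hg : g ∉ Subgroup.center (GL (Fin 2) F)) (h : g ^ 3 ∈ Subgroup.center (GL (Fin 2) F)) :
    g.val.trace ^ 2 = g.val.det := by
  contrapose! hg
  rw [mem_center_iff_entries] at h ⊢
  simp only [pow_succ, pow_zero, one_mul, Units.val_mul, Matrix.mul_apply,
    Fin.sum_univ_two] at h
  rw [Matrix.trace_fin_two, Matrix.det_fin_two, ← sub_ne_zero] at hg
  obtain ⟨h1, h2, h3⟩ := h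
  refine ⟨?_, ?_, ?_⟩ <;> apply mul_left_cancel₀ hg
  · linear_combination h1
  · linear_combination h2
  · linear_combination h3

lemma trace_det_of_pow_five_mem_center {g : GL (Fin 2) F}
    (hg : g ∉ Subgroup.center (GL (Fin 2) F)) (h : g ^ 5 ∈ Subgroup.center (GL (Fin 2) F)) :
    g.val.trace ^ 4 - 3 * g.val.trace ^ 2 * g.val.det + g.val.det ^ 2 = 0 := by
  contrapose! hg
  rw [mem_center_iff_entries] at h ⊢
  simp only [pow_succ, pow_zero, one_mul, Units.val_mul, Matrix.mul_apply,
    Fin.sum_univ_two] at h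
  rw [Matrix.trace_fin_two, Matrix.det_fin_two] at hg
  obtain ⟨h1, h2, h3⟩ := h
  refine ⟨?_, ?_, ?_⟩ <;> apply mul_left_cancel₀ hg
  · linear_combination h1
  · linear_combination h2
  · linear_combination h3

/-- Two anticommuting square roots of `-1` in `M₂(F)` are simultaneously conjugate to `i`, `j`. -/
lemma exists_conj_quat (h2 : (2 : F) ≠ 0) {x y : F} (h : x ^ 2 + y ^ 2 = -1)
    {A B : Matrix (Fin 2) (Fin 2) F} (hA : A * A = -1) (hB : B * B = -1)
    (hAB : B * A = -(A * B)) :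
    ∃ P : GL (Fin 2) F, P.val * A = quat x y 0 1 0 0 * P.val ∧
      P.val * B = quat x y 0 0 1 0 * P.val := by
  have hsing : (B - y • A - x • (1 : Matrix (Fin 2) (Fin 2) F)).det = 0 := by
    by_contra hd
    have hprod : (B - y • A - x • (1 : Matrix (Fin 2) (Fin 2) F)) *
        (B - y • A + x • (1 : Matrix (Fin 2) (Fin 2) F)) = 0 := by
      have : (B - y • A - x • (1 : Matrix (Fin 2) (Fin 2) F)) *
        (B - y • A + x • (1 : Matrix (Fin 2) (Fin 2) F)) =
          B * B - y • (A * B) - y • (B * A) + (y * y) • (A * A) -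
            (x * x) • (1 : Matrix (Fin 2) (Fin 2) F) := by
        simp only [sub_mul, mul_add, mul_sub, smul_mul_assoc, mul_smul_comm, mul_one, one_mul,
          smul_smul, smul_sub, mul_comm x y]
        abel
      rw [this, hA, hB, hAB]
      have hyy : y * y = -1 - x * x := by linear_combination h
      rw [hyy]
      simp only [sub_smul, smul_neg, neg_smul, one_smul]
      abel
    have hu := (Matrix.isUnit_iff_isUnit_det _).2 (isUnit_iff_ne_zero.2 hd)
    have hB' : B = y • A - x • (1 : Matrix (Fin 2) (Fin 2) F) := by
      have := (hu.mul_right_eq_zero).1 hprod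
      rw [← sub_eq_zero, ← this]
      abel
    have hcomm : B * A = A * B := by
      rw [hB']
      simp only [sub_mul, mul_sub, smul_mul_assoc, mul_smul_comm, mul_one, one_mul]
    have h0 : A * B = 0 := by
      have h' : (2 : F) • (A * B) = 0 := by
        rw [two_smul]
        nth_rw 1 [← hcomm]
        rw [hAB, neg_add_cancel]
      exact (smul_eq_zero.1 h').resolve_left h2
    have : A * A * (B * B) = 0 := by
      rw [mul_assoc, ← mul_assoc A B B, h0, zero_mul, mul_zero]
    rw [hA, hB] at this
    simp at this
  obtain ⟨v, hv0, hv⟩ := Matrix.exists_mulVec_eq_zero_iff.2 hsing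
  have hBv : B *ᵥ v = x • v + y • (A *ᵥ v) := by
    rw [Matrix.sub_mulVec, Matrix.sub_mulVec, Matrix.smul_mulVec, Matrix.smul_mulVec,
      Matrix.one_mulVec] at hv
    rw [← sub_eq_zero, ← hv]
    abel
  have hAAv : A *ᵥ (A *ᵥ v) = -v := by
    rw [Matrix.mulVec_mulVec, hA, Matrix.neg_mulVec, Matrix.one_mulVec]
  have hBAv : B *ᵥ (A *ᵥ v) = y • v - x • (A *ᵥ v) := by
    rw [Matrix.mulVec_mulVec, hAB, Matrix.neg_mulVec, ← Matrix.mulVec_mulVec, hBv,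
      Matrix.mulVec_add, Matrix.mulVec_smul, Matrix.mulVec_smul, hAAv]
    simp only [smul_neg]
    abel
  generalize hw : A *ᵥ v = w at *
  have hdet : v 0 * w 1 - v 1 * w 0 ≠ 0 := by
    intro h0
    obtain ⟨l, hl⟩ : ∃ l : F, w = l • v := by
      by_cases hv00 : v 0 = 0
      · have hv01 : v 1 ≠ 0 := fun hv01 ↦ hv0 (by ext i; fin_cases i <;> simp [hv00, hv01])
        refine ⟨w 1 / v 1, ?_⟩
        ext i
        fin_cases i
        · simp only [Fin.zero_eta, Pi.smul_apply, smul_eq_mul]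
          field_simp
          linear_combination -h0
        · simp [hv01]
      · refine ⟨w 0 / v 0, ?_⟩
        ext i
        fin_cases i
        · simp [hv00]
        · simp only [Fin.mk_one, Pi.smul_apply, smul_eq_mul]
          field_simp
          linear_combination h0
    have hll : (l * l + 1) • v = 0 := by
      rw [hl, Matrix.mulVec_smul, hw, hl, smul_smul] at hAAv
      rw [add_smul, hAAv, one_smul, neg_add_cancel]
    have hll' := (smul_eq_zero.1 hll).resolve_right hv0
    have hlxy : (2 * (l * x - y)) • v = 0 := by
      have h3 : l • (x • v + y • l • v) = y • v - x • l • v := by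
        rw [← hl, ← hBv, ← hBAv, ← Matrix.mulVec_smul, ← hl]
      rw [← sub_eq_zero] at h3
      rw [← h3]
      simp only [smul_smul, ← add_smul, ← sub_smul]
      congr 1
      linear_combination -y * hll'
    have hlxy' := (mul_eq_zero.1 ((smul_eq_zero.1 hlxy).resolve_right hv0)).resolve_left h2
    refine one_ne_zero (α := F) ?_
    linear_combination h - x ^ 2 * hll' + (l * x + y) * hlxy'
  let Q := Matrix.GeneralLinearGroup.mkOfDetNeZero !![v 0, w 0; v 1, w 1]
    (by rw [Matrix.det_fin_two_of]; convert hdet using 1; ring)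
  have hQ : Q.val = !![v 0, w 0; v 1, w 1] := rfl
  have e00 := congrFun hw 0
  have e01 := congrFun hw 1
  have e10 := congrFun hAAv 0
  have e11 := congrFun hAAv 1
  have f00 := congrFun hBv 0
  have f01 := congrFun hBv 1
  have f10 := congrFun hBAv 0
  have f11 := congrFun hBAv 1
  simp only [Matrix.mulVec, dotProduct, Fin.sum_univ_two, Pi.neg_apply, Pi.add_apply,
    Pi.smul_apply, Pi.sub_apply, smul_eq_mul] at e00 e01 e10 e11 f00 f01 f10 f11
  have hAQ : A * Q.val = Q.val * quat x y 0 1 0 0 := by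
    rw [hQ]
    ext i j
    fin_cases i <;> fin_cases j <;>
      simp [quat, Matrix.mul_apply, Fin.sum_univ_two, e00, e01, e10, e11]
  have hBQ : B * Q.val = Q.val * quat x y 0 0 1 0 := by
    rw [hQ]
    ext i j
    fin_cases i <;> fin_cases j <;>
      simp [quat, Matrix.mul_apply, Fin.sum_univ_two, f00, f01, f10, f11] <;> ring
  refine ⟨Q⁻¹, ?_, ?_⟩
  · rw [Units.inv_mul_eq_iff_eq_mul, ← mul_assoc, ← hAQ, mul_assoc, Units.mul_inv, mul_one]
  · rw [Units.inv_mul_eq_iff_eq_mul, ← mul_assoc, ← hBQ, mul_assoc, Units.mul_inv, mul_one]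

end Quaternions

section ProjectiveLifts

open scoped commutatorElement

variable {F : Type*} [Field F]

/-- The units `u` of `F` such that the scalar matrix `u` belongs to `K`. -/
def scalars (K : Subgroup (GL (Fin 2) F)) : Subgroup Fˣ :=
  K.comap (Matrix.GeneralLinearGroup.scalar (Fin 2))

/-- The underlying matrices of the elements of `K`. -/
def matrices (K : Subgroup (GL (Fin 2) F)) : Submonoid (Matrix (Fin 2) (Fin 2) F) :=
  K.toSubmonoid.map (Units.coeHom _)

/-- The subgroup generated by the scalars in `Z` and the invertible matrices in `S`. -/
def genBy (Z : Subgroup Fˣ) (S : Set (Matrix (Fin 2) (Fin 2) F)) : Subgroup (GL (Fin 2) F) :=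
  Z.map (Matrix.GeneralLinearGroup.scalar (Fin 2)) ⊔ Subgroup.closure {g | g.val ∈ S}

lemma val_mem_matrices {K : Subgroup (GL (Fin 2) F)} {g : GL (Fin 2) F} :
    g.val ∈ matrices K ↔ g ∈ K := by
  constructor
  · rintro ⟨g', hg', h⟩
    rwa [← Units.ext h]
  · exact fun hg ↦ ⟨g, hg, rfl⟩

lemma mem_matrices_genBy {Z : Subgroup Fˣ} {S : Set (Matrix (Fin 2) (Fin 2) F)}
    {M : Matrix (Fin 2) (Fin 2) F} (hM : M ∈ S) (hd : M.det ≠ 0) : M ∈ matrices (genBy Z S) :=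
  val_mem_matrices (g := Matrix.GeneralLinearGroup.mkOfDetNeZero M hd).2
    (le_sup_right (a := Z.map _) (Subgroup.subset_closure hM))

lemma smul_mem_matrices {K : Subgroup (GL (Fin 2) F)} {u : Fˣ} (hu : u ∈ scalars K)
    {M : Matrix (Fin 2) (Fin 2) F} (hM : M ∈ matrices K) : u.val • M ∈ matrices K := by
  have h : (Matrix.GeneralLinearGroup.scalar (Fin 2) u).val ∈ matrices K := val_mem_matrices.2 hu
  have := mul_mem h hM
  rwa [Matrix.GeneralLinearGroup.coe_scalar, Matrix.scalar_apply,
    ← Matrix.smul_eq_diagonal_mul] at this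

lemma le_scalars_genBy (Z : Subgroup Fˣ) (S : Set (Matrix (Fin 2) (Fin 2) F)) :
    Z ≤ scalars (genBy Z S) := fun _ hu ↦
  le_sup_left (a := Z.map _) (Subgroup.mem_map_of_mem _ hu)

lemma conj_scalar (P : GL (Fin 2) F) (u : Fˣ) :
    P * Matrix.GeneralLinearGroup.scalar (Fin 2) u * P⁻¹ =
      Matrix.GeneralLinearGroup.scalar (Fin 2) u := by
  rw [← Matrix.GeneralLinearGroup.scalar_commute, mul_inv_cancel_right]

lemma scalars_map_conj (P : GL (Fin 2) F) (K : Subgroup (GL (Fin 2) F)) :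
    scalars (K.map (MulAut.conj P).toMonoidHom) = scalars K := by
  ext u
  simp only [scalars, Subgroup.mem_comap, Subgroup.mem_map]
  constructor
  · rintro ⟨g, hg, h⟩
    have : g = Matrix.GeneralLinearGroup.scalar (Fin 2) u := by
      rw [← conj_scalar P⁻¹ u, ← h]
      simp [mul_assoc]
    rwa [← this]
  · exact fun h ↦ ⟨_, h, conj_scalar P u⟩

lemma map_conj_genBy (P : GL (Fin 2) F) {Z : Subgroup Fˣ} {S S' : Set (Matrix (Fin 2) (Fin 2) F)}
    (h : ∀ g : GL (Fin 2) F, g.val ∈ S → P * g * P⁻¹ ∈ genBy Z S')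
    (h' : ∀ g : GL (Fin 2) F, g.val ∈ S' → P⁻¹ * g * P ∈ genBy Z S) :
    (genBy Z S).map (MulAut.conj P).toMonoidHom = genBy Z S' := by
  apply le_antisymm
  · rw [Subgroup.map_le_iff_le_comap]
    refine sup_le ?_ ((Subgroup.closure_le _).2 h)
    rintro _ ⟨u, hu, rfl⟩
    refine Subgroup.mem_comap.2 ?_
    change P * _ * P⁻¹ ∈ _
    rw [conj_scalar]
    exact le_scalars_genBy Z S' hu
  · refine sup_le ?_ ((Subgroup.closure_le _).2 fun g hg ↦ ⟨_, h' g hg, by simp [mul_assoc]⟩)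
    rintro _ ⟨u, hu, rfl⟩
    exact ⟨_, le_scalars_genBy Z S hu, conj_scalar P u⟩

lemma genBy_congr {Z : Subgroup Fˣ} {S S' : Set (Matrix (Fin 2) (Fin 2) F)}
    (h : ∀ M ∈ S, M ∈ matrices (genBy Z S')) (h' : ∀ M ∈ S', M ∈ matrices (genBy Z S)) :
    genBy Z S = genBy Z S' := by
  have := map_conj_genBy (1 : GL (Fin 2) F) (Z := Z) (S := S) (S' := S')
    (fun g hg ↦ by simpa using val_mem_matrices.1 (h _ hg))
    (fun g hg ↦ by simpa using val_mem_matrices.1 (h' _ hg))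
  rw [← this]
  ext g
  simp

variable {Γ H : Type*} [Group Γ] [Group H]

/-- `π` identifies the image in `PGL₂(F)` of the representation `f` with the group `H`. -/
structure LiftsTo (f : Γ →* GL (Fin 2) F) (π : Γ →* H) : Prop where
  surjective : Function.Surjective π
  eq_one_iff : ∀ γ, π γ = 1 ↔ f γ ∈ Subgroup.center (GL (Fin 2) F)

namespace LiftsTo

variable {f : Γ →* GL (Fin 2) F} {π : Γ →* H}

lemma conj (h : LiftsTo f π) (P : GL (Fin 2) F) :
    LiftsTo ((MulAut.conj P).toMonoidHom.comp f) π where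
  surjective := h.surjective
  eq_one_iff γ := by
    rw [h.eq_one_iff]
    constructor
    · intro hγ
      simpa using Subgroup.Normal.conj_mem inferInstance _ hγ P
    · intro hγ
      simpa [mul_assoc] using Subgroup.Normal.conj_mem inferInstance _ hγ P⁻¹

lemma exists_smul (h : LiftsTo f π) {γ γ' : Γ} (e : π γ = π γ') :
    ∃ z : F, (f γ).val = z • (f γ').val := by
  have h1 : π (γ * γ'⁻¹) = 1 := by rw [map_mul, map_inv, e, mul_inv_cancel]
  rw [h.eq_one_iff, Matrix.GeneralLinearGroup.center_eq_range_scalar] at h1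
  obtain ⟨u, hu⟩ := h1
  rw [map_mul, map_inv, eq_mul_inv_iff_mul_eq] at hu
  refine ⟨u, ?_⟩
  rw [← hu, Units.val_mul, Matrix.GeneralLinearGroup.coe_scalar, Matrix.scalar_apply,
    ← Matrix.smul_eq_diagonal_mul]

lemma exists_mul_eq_smul (h : LiftsTo f π) {γ δ δ' : Γ} (e : π γ * π δ * (π γ)⁻¹ = π δ') :
    ∃ z : F, (f γ).val * (f δ).val = z • ((f δ').val * (f γ).val) := by
  have e' : π (γ * δ) = π (δ' * γ) := by
    rw [map_mul, map_mul, ← e, inv_mul_cancel_right]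
  simpa using h.exists_smul e'

lemma range_eq_genBy (h : LiftsTo f π) {T : Set Γ} (hT : Subgroup.closure (π '' T) = ⊤)
    {S : Set (Matrix (Fin 2) (Fin 2) F)} (hTS : ∀ t ∈ T, f t ∈ genBy (scalars f.range) S)
    (hS : ∀ M ∈ S, M ∈ matrices f.range) : f.range = genBy (scalars f.range) S := by
  apply le_antisymm
  · rintro _ ⟨γ, rfl⟩
    have hγ : π γ ∈ Subgroup.closure (π '' T) := hT ▸ Subgroup.mem_top _
    rw [← MonoidHom.map_closure] at hγ
    obtain ⟨t, ht, e⟩ := hγ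
    have h1 : π (γ * t⁻¹) = 1 := by rw [map_mul, map_inv, e, mul_inv_cancel]
    rw [h.eq_one_iff, Matrix.GeneralLinearGroup.center_eq_range_scalar] at h1
    obtain ⟨u, hu⟩ := h1
    have hu' : u ∈ scalars f.range := ⟨_, hu.symm⟩
    have ht' : f t ∈ genBy (scalars f.range) S :=
      (Subgroup.closure_le ((genBy (scalars f.range) S).comap f)).2 hTS ht
    have := mul_mem (Subgroup.mem_comap.1 (le_scalars_genBy _ S hu')) ht'
    rwa [hu, ← map_mul, inv_mul_cancel_right] at this
  · refine sup_le ?_ ((Subgroup.closure_le _).2 fun g hg ↦ val_mem_matrices.1 (hS _ hg))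
    rw [Subgroup.map_le_iff_le_comap]
    exact le_rfl

lemma det_commutator (f : Γ →* GL (Fin 2) F) (a b : Γ) : (f ⁅a, b⁆).val.det = 1 := by
  have : Matrix.GeneralLinearGroup.det (f ⁅a, b⁆) = 1 := by
    rw [map_commutatorElement, map_commutatorElement, commutatorElement_eq_one_iff_commute]
    exact Commute.all _ _
  exact congrArg Units.val this

lemma trace_eq_zero (h : LiftsTo f π) {γ : Γ} (h1 : π γ ≠ 1) (h2 : π γ ^ 2 = 1) :
    (f γ).val.trace = 0 :=
  trace_eq_zero_of_sq_mem_center (fun hc ↦ h1 ((h.eq_one_iff γ).2 hc))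
    (by rw [← map_pow, ← h.eq_one_iff, map_pow, h2])

lemma trace_sq_eq_det (h : LiftsTo f π) {γ : Γ} (h1 : π γ ≠ 1) (h3 : π γ ^ 3 = 1) :
    (f γ).val.trace ^ 2 = (f γ).val.det :=
  trace_sq_eq_det_of_pow_three_mem_center (fun hc ↦ h1 ((h.eq_one_iff γ).2 hc))
    (by rw [← map_pow, ← h.eq_one_iff, map_pow, h3])

lemma trace_det_eq_zero (h : LiftsTo f π) {γ : Γ} (h1 : π γ ≠ 1) (h5 : π γ ^ 5 = 1) :
    (f γ).val.trace ^ 4 - 3 * (f γ).val.trace ^ 2 * (f γ).val.det + (f γ).val.det ^ 2 = 0 :=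
  trace_det_of_pow_five_mem_center (fun hc ↦ h1 ((h.eq_one_iff γ).2 hc))
    (by rw [← map_pow, ← h.eq_one_iff, map_pow, h5])

end LiftsTo

lemma mul_self_of_trace_eq_zero {M : Matrix (Fin 2) (Fin 2) F} (ht : M.trace = 0)
    (hd : M.det = 1) : M * M = -1 := by
  rw [Matrix.trace_fin_two] at ht
  rw [Matrix.det_fin_two] at hd
  ext i j
  fin_cases i <;> fin_cases j <;> simp [Matrix.mul_apply, Fin.sum_univ_two]
  · linear_combination M 0 0 * ht - hd
  · linear_combination M 0 1 * ht
  · linear_combination M 1 0 * ht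
  · linear_combination M 1 1 * ht - hd

lemma mul_comm_neg_of_trace_eq_zero {A B : Matrix (Fin 2) (Fin 2) F} (hA : A.trace = 0)
    (hB : B.trace = 0) (hAB : (A * B).trace = 0) : B * A = -(A * B) := by
  rw [Matrix.trace_fin_two] at hA hB
  simp only [Matrix.trace_fin_two, Matrix.mul_apply, Fin.sum_univ_two] at hAB
  ext i j
  fin_cases i <;> fin_cases j <;> simp [Matrix.mul_apply, Fin.sum_univ_two]
  · linear_combination hAB + A 0 0 * hB + B 0 0 * hA - (A 0 0 + A 1 1) * hB
  · linear_combination A 0 1 * hB + B 0 1 * hA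
  · linear_combination A 1 0 * hB + B 1 0 * hA
  · linear_combination hAB - A 0 0 * hB - B 0 0 * hA + (A 0 0 + A 1 1) * hB

/-- Relations satisfied by two double transpositions `a`, `b = c a c⁻¹` and a `3`-cycle `c`
in the alternating group `A₄`. -/
structure IsTetrahedralTriple (a b c : H) : Prop where
  ne_one : a ≠ 1
  sq_eq_one : a ^ 2 = 1
  mul_ne_one : a * b ≠ 1
  mul_sq_eq_one : (a * b) ^ 2 = 1
  conj_left : c * a * c⁻¹ = b
  conj_right : c * b * c⁻¹ = a * b

namespace LiftsTo

variable {f : Γ →* GL (Fin 2) F} {π : Γ →* H}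

/-- A lift of a copy of `A₄`, generated by `a`, `b = c a c⁻¹` and `c`, can be conjugated so that
`a`, `b` lift to `i`, `j`, and `c` to a multiple of `1 + i + j + k` or of `(1 + i + j + k) i`. -/
lemma exists_conj_tetrahedral (h : LiftsTo f π) (h2 : (2 : F) ≠ 0) {x y : F}
    (hxy : x ^ 2 + y ^ 2 = -1) {a b c : H} (habc : IsTetrahedralTriple a b c)
    {γc : Γ} (hγc : π γc = c) :
    ∃ (P : GL (Fin 2) F) (γa γb : Γ), π γa = a ∧ π γb = b ∧
      (P * f γa * P⁻¹).val = quat x y 0 1 0 0 ∧ (P * f γb * P⁻¹).val = quat x y 0 0 1 0 ∧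
      ∃ s : F, s ≠ 0 ∧ ((P * f γc * P⁻¹).val = quat x y s s s s ∨
        (P * f γc * P⁻¹).val = quat x y s (-s) (-s) s) := by
  obtain ⟨ha, haa, hab, habab, hca, hcb⟩ := habc
  obtain ⟨γ', hγ'⟩ := h.surjective b
  have hb : b ≠ 1 := by
    rintro rfl
    exact ha (by simpa using hca)
  have hbb : b ^ 2 = 1 := by rw [← hca, conj_pow, haa, mul_one, mul_inv_cancel]
  have hba : b * a = a * b := by
    have e1 : a⁻¹ = a := inv_eq_of_mul_eq_one_left (by rw [← sq, haa])
    have e2 : b⁻¹ = b := inv_eq_of_mul_eq_one_left (by rw [← sq, hbb])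
    have e3 : (a * b)⁻¹ = a * b := inv_eq_of_mul_eq_one_left (by rw [← sq, habab])
    rw [← e3, _root_.mul_inv_rev, e1, e2]
  set γa := ⁅γ', γc⁆ with hγa
  have hπa : π γa = a := by
    have e2 : b⁻¹ = b := inv_eq_of_mul_eq_one_left (by rw [← sq, hbb])
    rw [hγa, map_commutatorElement, hγ', hγc, commutatorElement_def, e2, mul_assoc, mul_assoc,
      ← mul_assoc c, hcb, ← hba, ← mul_assoc, ← sq, hbb, one_mul]
  set γb := γc * γa * γc⁻¹ with hγb
  have hπb : π γb = b := by rw [hγb, map_mul, map_mul, map_inv, hγc, hπa, hca]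
  have hta := h.trace_eq_zero (γ := γa) (by rwa [hπa]) (by rwa [hπa])
  have htb := h.trace_eq_zero (γ := γb) (by rwa [hπb]) (by rwa [hπb])
  have htab := h.trace_eq_zero (γ := γa * γb) (by rwa [map_mul, hπa, hπb])
    (by rwa [map_mul, hπa, hπb])
  rw [map_mul, Units.val_mul] at htab
  have hda : (f γa).val.det = 1 := det_commutator f _ _
  have hdb : (f γb).val.det = 1 := by
    rw [hγb, map_mul, map_mul, map_inv, Units.val_mul, Units.val_mul, Matrix.det_mul_right_comm,
      ← Units.val_mul, mul_inv_cancel, Units.val_one, one_mul, hda]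
  obtain ⟨P, hPa, hPb⟩ := exists_conj_quat h2 hxy (mul_self_of_trace_eq_zero hta hda)
    (mul_self_of_trace_eq_zero htb hdb) (mul_comm_neg_of_trace_eq_zero hta htb htab)
  have h' := h.conj P
  set f' := (MulAut.conj P).toMonoidHom.comp f with hf'
  have hf'γ : ∀ γ, f' γ = P * f γ * P⁻¹ := fun γ ↦ rfl
  have hia : (f' γa).val = quat x y 0 1 0 0 := by
    rw [hf'γ, Units.val_mul, Units.val_mul, hPa, mul_assoc, Units.mul_inv, mul_one]
  have hjb : (f' γb).val = quat x y 0 0 1 0 := by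
    rw [hf'γ, Units.val_mul, Units.val_mul, hPb, mul_assoc, Units.mul_inv, mul_one]
  refine ⟨P, γa, γb, hπa, hπb, hia, hjb, ?_⟩
  rw [← hf'γ]
  obtain ⟨a₀, b₀, c₀, d₀, hC⟩ := exists_eq_quat h2 hxy (f' γc).val
  have hCi : (f' γc).val * (f' γa).val = (f' γb).val * (f' γc).val := by
    rw [← Units.val_mul, ← Units.val_mul, ← map_mul, ← map_mul, hγb, inv_mul_cancel_right]
  obtain ⟨z, hz⟩ := h'.exists_mul_eq_smul (γ := γc) (δ := γb) (δ' := γa * γb)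
    (by rw [map_mul π γa γb, hγc, hπa, hπb, hcb])
  rw [hia, hjb, hC, quat_mul hxy, quat_mul hxy] at hCi
  rw [map_mul f' γa γb, Units.val_mul, hia, hjb, hC, quat_mul hxy, quat_mul hxy, quat_mul hxy,
    smul_quat] at hz
  obtain ⟨e1, e2, e3, e4⟩ := quat_inj h2 hxy hCi
  obtain ⟨k1, k2, k3, k4⟩ := quat_inj h2 hxy hz
  have hb₀ : b₀ = z * a₀ := by linear_combination k4
  have hc₀ : c₀ = z * a₀ := by linear_combination hb₀ + e1
  have hd₀ : d₀ = a₀ := by linear_combination -e2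
  have ha₀ : a₀ ≠ 0 := by
    rintro rfl
    have hdet := (Matrix.isUnit_iff_isUnit_det _).1 (f' γc).isUnit
    rw [hC, quat_det hxy, hb₀, hc₀, hd₀] at hdet
    simp at hdet
  have hz2 : (z - 1) * (z + 1) = 0 := by
    apply mul_left_cancel₀ ha₀
    linear_combination -k3 - z * hb₀
  refine ⟨a₀, ha₀, ?_⟩
  rw [hC, hb₀, hc₀, hd₀]
  rcases mul_eq_zero.1 hz2 with hz | hz
  · left
    rw [sub_eq_zero.1 hz, one_mul]
  · right
    rw [eq_neg_of_add_eq_zero_left hz, neg_one_mul]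

end LiftsTo

lemma quat_half_det_ne_zero (h2 : (2 : F) ≠ 0) {x y : F} (hxy : x ^ 2 + y ^ 2 = -1) :
    (quat x y (1 / 2) (1 / 2) (1 / 2) (1 / 2)).det ≠ 0 := by
  rw [quat_det hxy]
  convert one_ne_zero (α := F) using 1
  field_simp
  ring

lemma quat_icosahedral_det_ne_zero (h2 : (2 : F) ≠ 0) {x y p : F} (hxy : x ^ 2 + y ^ 2 = -1)
    (hp : p ^ 2 = p + 1) : (quat x y 0 (p / 2) ((p - 1) / 2) (1 / 2)).det ≠ 0 := by
  rw [quat_det hxy]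
  convert one_ne_zero (α := F) using 1
  field_simp
  linear_combination 2 * hp

section Submonoid

variable {x y : F} {K : Submonoid (Matrix (Fin 2) (Fin 2) F)}

lemma neg_mem_of_quat_mem (hxy : x ^ 2 + y ^ 2 = -1) (hi : quat x y 0 1 0 0 ∈ K)
    {M : Matrix (Fin 2) (Fin 2) F} (hM : M ∈ K) : -M ∈ K := by
  have h1 : (-1 : Matrix (Fin 2) (Fin 2) F) ∈ K := by
    convert mul_mem hi hi using 1
    rw [quat_mul hxy]
    ext i j
    fin_cases i <;> fin_cases j <;> simp [quat]
  simpa using mul_mem h1 hM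

lemma quat_k_mem (hxy : x ^ 2 + y ^ 2 = -1) (hi : quat x y 0 1 0 0 ∈ K)
    (hj : quat x y 0 0 1 0 ∈ K) : quat x y 0 0 0 1 ∈ K := by
  convert mul_mem hi hj using 1
  rw [quat_mul hxy]
  congr 1 <;> ring

lemma quat_flip_i_mem (hxy : x ^ 2 + y ^ 2 = -1) (hi : quat x y 0 1 0 0 ∈ K) {b c d : F}
    (h : quat x y 0 b c d ∈ K) : quat x y 0 (-b) c d ∈ K := by
  convert mul_mem (mul_mem hi h) hi using 1
  rw [quat_mul hxy, quat_mul hxy]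
  congr 1 <;> ring

lemma quat_flip_j_mem (hxy : x ^ 2 + y ^ 2 = -1) (hj : quat x y 0 0 1 0 ∈ K) {b c d : F}
    (h : quat x y 0 b c d ∈ K) : quat x y 0 b (-c) d ∈ K := by
  convert mul_mem (mul_mem hj h) hj using 1
  rw [quat_mul hxy, quat_mul hxy]
  congr 1 <;> ring

lemma quat_flip_k_mem (hxy : x ^ 2 + y ^ 2 = -1) (hk : quat x y 0 0 0 1 ∈ K) {b c d : F}
    (h : quat x y 0 b c d ∈ K) : quat x y 0 b c (-d) ∈ K := by
  convert mul_mem (mul_mem hk h) hk using 1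
  rw [quat_mul hxy, quat_mul hxy]
  congr 1 <;> ring

lemma quat_omega_mem_iff (hxy : x ^ 2 + y ^ 2 = -1) (hi : quat x y 0 1 0 0 ∈ K) {s : F} :
    quat x y s (-s) (-s) s ∈ K ↔ quat x y s s s s ∈ K := by
  constructor
  · intro h
    convert mul_mem h hi using 1
    rw [quat_mul hxy]
    congr 1 <;> ring
  · intro h
    convert neg_mem_of_quat_mem hxy hi (mul_mem h hi) using 1
    rw [quat_mul hxy, quat_neg]
    congr 1 <;> ring

lemma quat_neg_mem_iff (hxy : x ^ 2 + y ^ 2 = -1) (hi : quat x y 0 1 0 0 ∈ K) {a b c d : F} :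
    quat x y (-a) (-b) (-c) (-d) ∈ K ↔ quat x y a b c d ∈ K := by
  rw [← quat_neg]
  exact ⟨fun h ↦ by simpa using neg_mem_of_quat_mem hxy hi h, neg_mem_of_quat_mem hxy hi⟩

lemma quat_half_mem_iff (h2 : (2 : F) ≠ 0) (hxy : x ^ 2 + y ^ 2 = -1)
    (hi : quat x y 0 1 0 0 ∈ K) {s : F} {M : Matrix (Fin 2) (Fin 2) F}
    (hM : M = quat x y s s s s ∨ M = quat x y s (-s) (-s) s) (hdet : M.det = 1) :
    M ∈ K ↔ quat x y (1 / 2) (1 / 2) (1 / 2) (1 / 2) ∈ K := by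
  have h1 : M ∈ K ↔ quat x y s s s s ∈ K := by
    rcases hM with rfl | rfl
    · rfl
    · exact quat_omega_mem_iff hxy hi
  have hs : s = 1 / 2 ∨ s = -(1 / 2) := by
    apply sq_eq_sq_iff_eq_or_eq_neg.1
    have : 4 * s ^ 2 = 1 := by
      rw [← hdet]
      rcases hM with rfl | rfl <;> rw [quat_det hxy] <;> ring
    field_simp
    linear_combination this
  rw [h1]
  rcases hs with rfl | rfl
  · rfl
  · exact quat_neg_mem_iff hxy hi

lemma quat_octahedral_mem_iff (hxy : x ^ 2 + y ^ 2 = -1) (hi : quat x y 0 1 0 0 ∈ K) {s : F} :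
    quat x y s 0 0 s ∈ K ↔ quat x y 0 s s 0 ∈ K := by
  constructor
  · intro h
    convert mul_mem h hi using 1
    rw [quat_mul hxy]
    congr 1 <;> ring
  · intro h
    convert neg_mem_of_quat_mem hxy hi (mul_mem h hi) using 1
    rw [quat_mul hxy, quat_neg]
    congr 1 <;> ring

lemma quat_octahedral_mem_iff' (hxy : x ^ 2 + y ^ 2 = -1) (hi : quat x y 0 1 0 0 ∈ K)
    (hj : quat x y 0 0 1 0 ∈ K) {s : F} :
    quat x y s 0 0 (-s) ∈ K ↔ quat x y 0 s s 0 ∈ K := by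
  constructor
  · intro h
    convert mul_mem h hj using 1
    rw [quat_mul hxy]
    congr 1 <;> ring
  · intro h
    convert neg_mem_of_quat_mem hxy hi (mul_mem h hj) using 1
    rw [quat_mul hxy, quat_neg]
    congr 1 <;> ring

/-- Up to signs, the coordinates of `b i + c j + d k` are determined by the conditions expressing
that its products with `i` and `k` have projective orders `5` and `3`. -/
lemma exists_icosahedral (h2 : (2 : F) ≠ 0) (hxy : x ^ 2 + y ^ 2 = -1) {b c d : F}
    (hd : (2 * d) ^ 2 = 1) (hb : (2 * b) ^ 4 - 3 * (2 * b) ^ 2 + 1 = 0)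
    (hbcd : b ^ 2 + c ^ 2 + d ^ 2 = 1) :
    ∃ p : F, p ^ 2 = p + 1 ∧ ∀ K : Submonoid (Matrix (Fin 2) (Fin 2) F),
      quat x y 0 1 0 0 ∈ K → quat x y 0 0 1 0 ∈ K →
        (quat x y 0 b c d ∈ K ↔ quat x y 0 (p / 2) ((p - 1) / 2) (1 / 2) ∈ K) := by
  obtain ⟨p, hp, hbp⟩ : ∃ p : F, p ^ 2 = p + 1 ∧ (b = p / 2 ∨ b = -(p / 2)) := by
    have : ((2 * b) ^ 2 - 2 * b - 1) * ((2 * b) ^ 2 + 2 * b - 1) = 0 := by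
      linear_combination hb
    rcases mul_eq_zero.1 this with h | h
    · exact ⟨2 * b, by linear_combination h, Or.inl (by field_simp)⟩
    · exact ⟨-(2 * b), by linear_combination h, Or.inr (by field_simp)⟩
  have hcp : c = (p - 1) / 2 ∨ c = -((p - 1) / 2) := by
    apply sq_eq_sq_iff_eq_or_eq_neg.1
    have hb2 : b ^ 2 = (p / 2) ^ 2 := by rcases hbp with h | h <;> rw [h] <;> ring
    apply mul_left_cancel₀ (pow_ne_zero 2 h2)
    field_simp at hb2 ⊢
    linear_combination 4 * hbcd - hd - hb2 - 2 * hp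
  have hdp : d = 1 / 2 ∨ d = -(1 / 2) := by
    apply sq_eq_sq_iff_eq_or_eq_neg.1
    field_simp
    linear_combination hd
  refine ⟨p, hp, fun K hi hj ↦ ?_⟩
  have hk := quat_k_mem hxy hi hj
  have fi : ∀ {b c d : F}, quat x y 0 (-b) c d ∈ K ↔ quat x y 0 b c d ∈ K := fun {b c d} ↦
    ⟨fun h ↦ by simpa using quat_flip_i_mem hxy hi h, quat_flip_i_mem hxy hi⟩
  have fj : ∀ {b c d : F}, quat x y 0 b (-c) d ∈ K ↔ quat x y 0 b c d ∈ K := fun {b c d} ↦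
    ⟨fun h ↦ by simpa using quat_flip_j_mem hxy hj h, quat_flip_j_mem hxy hj⟩
  have fk : ∀ {b c d : F}, quat x y 0 b c (-d) ∈ K ↔ quat x y 0 b c d ∈ K := fun {b c d} ↦
    ⟨fun h ↦ by simpa using quat_flip_k_mem hxy hk h, quat_flip_k_mem hxy hk⟩
  rcases hbp with rfl | rfl <;> rcases hcp with rfl | rfl <;> rcases hdp with rfl | rfl
  all_goals simp only [fi, fj, fk]

end Submonoid

namespace LiftsTo

variable {f : Γ →* GL (Fin 2) F} {π : Γ →* H}

lemma exists_genBy_tetrahedral (h : LiftsTo f π) (h2 : (2 : F) ≠ 0) {x y : F}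
    (hxy : x ^ 2 + y ^ 2 = -1) {a b c : H} (habc : IsTetrahedralTriple a b c)
    (hgen : Subgroup.closure {a, b, c} = ⊤) :
    ∃ (P : GL (Fin 2) F) (s : F), s ≠ 0 ∧ f.range.map (MulAut.conj P).toMonoidHom =
      genBy (scalars f.range) {quat x y 0 1 0 0, quat x y 0 0 1 0, quat x y s s s s} := by
  obtain ⟨γc, hγc⟩ := h.surjective c
  obtain ⟨P, γa, γb, hγa, hγb, hi, hj, s, hs, hω⟩ := h.exists_conj_tetrahedral h2 hxy habc hγc
  refine ⟨P, s, hs, ?_⟩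
  rw [← scalars_map_conj P, ← MonoidHom.range_comp]
  set f' := (MulAut.conj P).toMonoidHom.comp f
  change (f' γa).val = _ at hi
  change (f' γb).val = _ at hj
  change (f' γc).val = _ ∨ (f' γc).val = _ at hω
  have hω' : ∀ K : Submonoid (Matrix (Fin 2) (Fin 2) F), quat x y 0 1 0 0 ∈ K →
      ((f' γc).val ∈ K ↔ quat x y s s s s ∈ K) := by
    intro K hK
    rcases hω with hω | hω <;> rw [hω]
    exact quat_omega_mem_iff hxy hK
  have hmem : ∀ γ, (f' γ).val ∈ matrices f'.range := fun γ ↦ val_mem_matrices.2 ⟨γ, rfl⟩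
  refine (h.conj P).range_eq_genBy (T := {γa, γb, γc})
    (by simpa [Set.image_insert_eq, hγa, hγb, hγc] using hgen) ?_ ?_
  · have hi' : quat x y 0 1 0 0 ∈ matrices (genBy (scalars f'.range)
        {quat x y 0 1 0 0, quat x y 0 0 1 0, quat x y s s s s}) :=
      mem_matrices_genBy (by simp) (by simp [quat_det hxy])
    rintro t (rfl | rfl | rfl) <;> rw [← val_mem_matrices]
    · rwa [hi]
    · rw [hj]
      exact mem_matrices_genBy (by simp) (by simp [quat_det hxy])
    · rw [hω' _ hi']
      refine mem_matrices_genBy (by simp) ?_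
      rw [quat_det hxy]
      convert mul_ne_zero (mul_ne_zero h2 h2) (pow_ne_zero 2 hs) using 1
      ring
  · have hi' := hmem γa
    rw [hi] at hi'
    rintro M (rfl | rfl | rfl)
    · exact hi'
    · exact hj ▸ hmem γb
    · exact (hω' _ hi').1 (hmem γc)

lemma exists_genBy_octahedral (h : LiftsTo f π) (h2 : (2 : F) ≠ 0) {x y : F}
    (hxy : x ^ 2 + y ^ 2 = -1) {a b c t : H} (habc : IsTetrahedralTriple a b c)
    (hta : t * a * t⁻¹ = b) (htb : t * b * t⁻¹ = a) (htc : ⁅t, c⁆ = c)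
    (hgen : Subgroup.closure {a, b, c, t} = ⊤) :
    ∃ (P : GL (Fin 2) F) (s : F), s ≠ 0 ∧ f.range.map (MulAut.conj P).toMonoidHom =
      genBy (scalars f.range) {quat x y 0 1 0 0, quat x y 0 0 1 0,
        quat x y (1 / 2) (1 / 2) (1 / 2) (1 / 2), quat x y 0 s s 0} := by
  obtain ⟨γt, hγt⟩ := h.surjective t
  obtain ⟨γ', hγ'⟩ := h.surjective c
  have hγc : π ⁅γt, γ'⁆ = c := by rw [map_commutatorElement, hγt, hγ', htc]
  obtain ⟨P, γa, γb, hγa, hγb, hi, hj, r, hr, hω⟩ := h.exists_conj_tetrahedral h2 hxy habc hγc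
  have h' := h.conj P
  set f' := (MulAut.conj P).toMonoidHom.comp f with hf'
  change (f' γa).val = _ at hi
  change (f' γb).val = _ at hj
  change (f' ⁅γt, γ'⁆).val = _ ∨ (f' ⁅γt, γ'⁆).val = _ at hω
  have hω' : ∀ K : Submonoid (Matrix (Fin 2) (Fin 2) F), quat x y 0 1 0 0 ∈ K →
      ((f' ⁅γt, γ'⁆).val ∈ K ↔ quat x y (1 / 2) (1 / 2) (1 / 2) (1 / 2) ∈ K) :=
    fun K hK ↦ quat_half_mem_iff h2 hxy hK hω (det_commutator f' _ _)
  obtain ⟨s, hs, hτ⟩ : ∃ s : F, s ≠ 0 ∧ ∀ K : Submonoid (Matrix (Fin 2) (Fin 2) F),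
      quat x y 0 1 0 0 ∈ K → quat x y 0 0 1 0 ∈ K →
        ((f' γt).val ∈ K ↔ quat x y 0 s s 0 ∈ K) := by
    obtain ⟨a₀, b₀, c₀, d₀, hT⟩ := exists_eq_quat h2 hxy (f' γt).val
    obtain ⟨z, hz⟩ := h'.exists_mul_eq_smul (γ := γt) (δ := γa) (δ' := γb)
      (by rw [hγt, hγa, hγb, hta])
    obtain ⟨w, hw⟩ := h'.exists_mul_eq_smul (γ := γt) (δ := γb) (δ' := γa)
      (by rw [hγt, hγa, hγb, htb])
    rw [hi, hj, hT, quat_mul hxy, quat_mul hxy, smul_quat] at hz hw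
    obtain ⟨e1, e2, e3, e4⟩ := quat_inj h2 hxy hz
    obtain ⟨k1, k2, k3, k4⟩ := quat_inj h2 hxy hw
    ring_nf at e1 e2 e3 e4 k1 k2 k3 k4
    by_cases hb : b₀ = 0
    · have hc : c₀ = 0 := by linear_combination -e4 + z * hb
      have hd : d₀ = z * a₀ := by linear_combination e3
      have ha : a₀ ≠ 0 := by
        rintro rfl
        have hdet := (Matrix.isUnit_iff_isUnit_det _).1 (f' γt).isUnit
        rw [hT, quat_det hxy, hb, hc, hd] at hdet
        simp at hdet
      have hz2 : (z - 1) * (z + 1) = 0 := by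
        apply mul_left_cancel₀ ha
        linear_combination -e2 - z * hd
      refine ⟨a₀, ha, fun K hiK hjK ↦ ?_⟩
      rw [hT, hb, hc, hd]
      rcases mul_eq_zero.1 hz2 with hz | hz
      · rw [sub_eq_zero.1 hz, one_mul]
        exact quat_octahedral_mem_iff hxy hiK
      · rw [eq_neg_of_add_eq_zero_left hz, neg_one_mul]
        exact quat_octahedral_mem_iff' hxy hiK hjK
    · have hc : c₀ = z * b₀ := by linear_combination -e4
      have hz2 : (z - 1) * (z + 1) = 0 := by
        apply mul_left_cancel₀ hb
        linear_combination e1 - z * hc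
      have hw1 : w = z := by
        apply mul_left_cancel₀ hb
        linear_combination k1 + hc
      have hz0 : z ≠ 0 := by
        rintro rfl
        simp at hz2
      have ha : a₀ = 0 := by
        apply mul_left_cancel₀ (mul_ne_zero h2 hz0)
        linear_combination -k2 - e3 - a₀ * hw1
      have hd : d₀ = 0 := by linear_combination e3 + z * ha
      refine ⟨b₀, hb, fun K hiK hjK ↦ ?_⟩
      rw [hT, ha, hc, hd]
      rcases mul_eq_zero.1 hz2 with hz | hz
      · rw [sub_eq_zero.1 hz, one_mul]
      · rw [eq_neg_of_add_eq_zero_left hz, neg_one_mul]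
        exact ⟨fun h ↦ by simpa using quat_flip_j_mem hxy hjK h, quat_flip_j_mem hxy hjK⟩
  refine ⟨P, s, hs, ?_⟩
  rw [← scalars_map_conj P, ← MonoidHom.range_comp, ← hf']
  have hmem : ∀ γ, (f' γ).val ∈ matrices f'.range := fun γ ↦ val_mem_matrices.2 ⟨γ, rfl⟩
  refine h'.range_eq_genBy (T := {γa, γb, ⁅γt, γ'⁆, γt})
    (by simpa only [Set.image_insert_eq, Set.image_singleton, hγa, hγb, hγc, hγt] using hgen)
    ?_ ?_
  · have hi' : quat x y 0 1 0 0 ∈ matrices (genBy (scalars f'.range) {quat x y 0 1 0 0,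
        quat x y 0 0 1 0, quat x y (1 / 2) (1 / 2) (1 / 2) (1 / 2), quat x y 0 s s 0}) :=
      mem_matrices_genBy (by simp) (by simp [quat_det hxy])
    have hj' : quat x y 0 0 1 0 ∈ matrices (genBy (scalars f'.range) {quat x y 0 1 0 0,
        quat x y 0 0 1 0, quat x y (1 / 2) (1 / 2) (1 / 2) (1 / 2), quat x y 0 s s 0}) :=
      mem_matrices_genBy (by simp) (by simp [quat_det hxy])
    rintro t (rfl | rfl | rfl | rfl) <;> rw [← val_mem_matrices]
    · rwa [hi]
    · rwa [hj]
    · rw [hω' _ hi']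
      exact mem_matrices_genBy (by simp) (quat_half_det_ne_zero h2 hxy)
    · rw [hτ _ hi' hj']
      refine mem_matrices_genBy (by simp) ?_
      rw [quat_det hxy]
      convert mul_ne_zero h2 (pow_ne_zero 2 hs) using 1
      ring
  · have hi' := hmem γa
    have hj' := hmem γb
    rw [hi] at hi'
    rw [hj] at hj'
    rintro M (rfl | rfl | rfl | rfl)
    · exact hi'
    · exact hj'
    · exact (hω' _ hi').1 (hmem _)
    · exact (hτ _ hi' hj').1 (hmem γt)

lemma exists_genBy_icosahedral (h : LiftsTo f π) (h2 : (2 : F) ≠ 0) {x y : F}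
    (hxy : x ^ 2 + y ^ 2 = -1) {a b c u p₁ q₁ p₂ q₂ : H} (habc : IsTetrahedralTriple a b c)
    (hc : ⁅p₁, q₁⁆ = c) (hu : ⁅p₂, q₂⁆ = u) (hu1 : u ≠ 1) (hu2 : u ^ 2 = 1)
    (hua1 : u * a ≠ 1) (hua5 : (u * a) ^ 5 = 1) (huab1 : u * (a * b) ≠ 1)
    (huab3 : (u * (a * b)) ^ 3 = 1) (hgen : Subgroup.closure {a, b, c, u} = ⊤) :
    ∃ (P : GL (Fin 2) F) (p : F), p ^ 2 = p + 1 ∧ f.range.map (MulAut.conj P).toMonoidHom =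
      genBy (scalars f.range) {quat x y 0 1 0 0, quat x y 0 0 1 0,
        quat x y (1 / 2) (1 / 2) (1 / 2) (1 / 2),
        quat x y 0 (p / 2) ((p - 1) / 2) (1 / 2)} := by
  obtain ⟨g₁, hg₁⟩ := h.surjective p₁
  obtain ⟨g₂, hg₂⟩ := h.surjective q₁
  obtain ⟨g₃, hg₃⟩ := h.surjective p₂
  obtain ⟨g₄, hg₄⟩ := h.surjective q₂
  have hγc : π ⁅g₁, g₂⁆ = c := by rw [map_commutatorElement, hg₁, hg₂, hc]
  have hγu : π ⁅g₃, g₄⁆ = u := by rw [map_commutatorElement, hg₃, hg₄, hu]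
  obtain ⟨P, γa, γb, hγa, hγb, hi, hj, r, hr, hω⟩ := h.exists_conj_tetrahedral h2 hxy habc hγc
  have h' := h.conj P
  set f' := (MulAut.conj P).toMonoidHom.comp f with hf'
  change (f' γa).val = _ at hi
  change (f' γb).val = _ at hj
  change (f' ⁅g₁, g₂⁆).val = _ ∨ (f' ⁅g₁, g₂⁆).val = _ at hω
  have hω' : ∀ K : Submonoid (Matrix (Fin 2) (Fin 2) F), quat x y 0 1 0 0 ∈ K →
      ((f' ⁅g₁, g₂⁆).val ∈ K ↔ quat x y (1 / 2) (1 / 2) (1 / 2) (1 / 2) ∈ K) :=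
    fun K hK ↦ quat_half_mem_iff h2 hxy hK hω (det_commutator f' _ _)
  have hdu : (f' ⁅g₃, g₄⁆).val.det = 1 := det_commutator f' _ _
  generalize ⁅g₃, g₄⁆ = γu at hγu hdu
  obtain ⟨p, hp, hτ⟩ : ∃ p : F, p ^ 2 = p + 1 ∧ ∀ K : Submonoid (Matrix (Fin 2) (Fin 2) F),
      quat x y 0 1 0 0 ∈ K → quat x y 0 0 1 0 ∈ K →
        ((f' γu).val ∈ K ↔ quat x y 0 (p / 2) ((p - 1) / 2) (1 / 2) ∈ K) := by
    obtain ⟨a₀, b₀, c₀, d₀, hU⟩ := exists_eq_quat h2 hxy (f' γu).val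
    have ht := h'.trace_eq_zero (γ := γu) (by rwa [hγu]) (by rwa [hγu])
    have ht3 := h'.trace_sq_eq_det (γ := γu * (γa * γb))
      (by rwa [map_mul, map_mul, hγu, hγa, hγb]) (by rwa [map_mul, map_mul, hγu, hγa, hγb])
    have ht5 := h'.trace_det_eq_zero (γ := γu * γa) (by rwa [map_mul, hγu, hγa])
      (by rwa [map_mul, hγu, hγa])
    rw [map_mul, Units.val_mul, Matrix.det_mul, hdu] at ht3 ht5
    rw [map_mul, Units.val_mul, Matrix.det_mul] at ht3
    rw [hi, hj, hU, quat_mul hxy, quat_mul hxy, quat_trace, quat_det hxy, quat_det hxy] at ht3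
    rw [hi, hU, quat_mul hxy, quat_trace, quat_det hxy] at ht5
    rw [hU, quat_det hxy] at hdu
    rw [hU, quat_trace] at ht
    obtain rfl := (mul_eq_zero.1 ht).resolve_left h2
    rw [hU]
    apply exists_icosahedral h2 hxy
    · linear_combination ht3
    · linear_combination ht5
    · linear_combination hdu
  refine ⟨P, p, hp, ?_⟩
  rw [← scalars_map_conj P, ← MonoidHom.range_comp, ← hf']
  have hmem : ∀ γ, (f' γ).val ∈ matrices f'.range := fun γ ↦ val_mem_matrices.2 ⟨γ, rfl⟩
  refine h'.range_eq_genBy (T := {γa, γb, ⁅g₁, g₂⁆, γu})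
    (by simpa only [Set.image_insert_eq, Set.image_singleton, hγa, hγb, hγc, hγu] using hgen)
    ?_ ?_
  · have hi' : quat x y 0 1 0 0 ∈ matrices (genBy (scalars f'.range) {quat x y 0 1 0 0,
        quat x y 0 0 1 0, quat x y (1 / 2) (1 / 2) (1 / 2) (1 / 2),
        quat x y 0 (p / 2) ((p - 1) / 2) (1 / 2)}) :=
      mem_matrices_genBy (by simp) (by simp [quat_det hxy])
    have hj' : quat x y 0 0 1 0 ∈ matrices (genBy (scalars f'.range) {quat x y 0 1 0 0,
        quat x y 0 0 1 0, quat x y (1 / 2) (1 / 2) (1 / 2) (1 / 2),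
        quat x y 0 (p / 2) ((p - 1) / 2) (1 / 2)}) :=
      mem_matrices_genBy (by simp) (by simp [quat_det hxy])
    rintro t (rfl | rfl | rfl | rfl) <;> rw [← val_mem_matrices]
    · rwa [hi]
    · rwa [hj]
    · rw [hω' _ hi']
      exact mem_matrices_genBy (by simp) (quat_half_det_ne_zero h2 hxy)
    · rw [hτ _ hi' hj']
      exact mem_matrices_genBy (by simp) (quat_icosahedral_det_ne_zero h2 hxy hp)
  · have hi' := hmem γa
    have hj' := hmem γb
    rw [hi] at hi'
    rw [hj] at hj'
    rintro M (rfl | rfl | rfl | rfl)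
    · exact hi'
    · exact hj'
    · exact (hω' _ hi').1 (hmem _)
    · exact (hτ _ hi' hj').1 (hmem γu)

end LiftsTo

end ProjectiveLifts

section Comparison

variable {F : Type*} [Field F]

lemma mem_scalars_of_smul_one_mem {K : Subgroup (GL (Fin 2) F)} {u : Fˣ}
    (h : u.val • (1 : Matrix (Fin 2) (Fin 2) F) ∈ matrices K) : u ∈ scalars K := by
  refine (val_mem_matrices (g := Matrix.GeneralLinearGroup.scalar (Fin 2) u)).1 ?_
  rwa [Matrix.GeneralLinearGroup.coe_scalar, Matrix.scalar_apply, ← Matrix.smul_one_eq_diagonal]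

lemma map_conj_genBy_of_matrices (P : GL (Fin 2) F) {Z : Subgroup Fˣ}
    {S S' : Set (Matrix (Fin 2) (Fin 2) F)}
    (h : ∀ M ∈ S, ∃ N ∈ matrices (genBy Z S'), P.val * M = N * P.val)
    (h' : ∀ M ∈ S', ∃ N ∈ matrices (genBy Z S), M * P.val = P.val * N) :
    (genBy Z S).map (MulAut.conj P).toMonoidHom = genBy Z S' := by
  refine map_conj_genBy P (fun g hg ↦ ?_) (fun g hg ↦ ?_)
  · obtain ⟨_, ⟨n, hn, rfl⟩, e⟩ := h _ hg
    have : P * g = n * P := Units.ext e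
    rw [this, mul_inv_cancel_right]
    exact hn
  · obtain ⟨_, ⟨n, hn, rfl⟩, e⟩ := h' _ hg
    have : g * P = P * n := Units.ext e
    rw [mul_assoc, this, inv_mul_cancel_left]
    exact hn

lemma exists_det_eq_of_mem_genBy {Z : Subgroup Fˣ} {S : Set (Matrix (Fin 2) (Fin 2) F)} {d : Fˣ}
    (hS : ∀ M ∈ S, M.det = 1 ∨ M.det = d) {g : GL (Fin 2) F} (hg : g ∈ genBy Z S) :
    ∃ z ∈ Z, ∃ n : ℤ, Matrix.GeneralLinearGroup.det g = z ^ 2 * d ^ n := by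
  have h : genBy Z S ≤
      (Z.map (powMonoidHom 2) ⊔ Subgroup.zpowers d).comap Matrix.GeneralLinearGroup.det := by
    refine sup_le ?_ ((Subgroup.closure_le _).2 fun g hg ↦ ?_)
    · rintro _ ⟨z, hz, rfl⟩
      refine le_sup_left (a := Z.map _) ⟨z, hz, ?_⟩
      ext
      simp
    · rcases hS _ hg with h | h
      · have : Matrix.GeneralLinearGroup.det g = 1 := Units.ext h
        exact Subgroup.mem_comap.2 (this ▸ one_mem _)
      · have : Matrix.GeneralLinearGroup.det g = d := Units.ext h
        exact le_sup_right (a := Z.map _) (this ▸ Subgroup.mem_zpowers _)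
  obtain ⟨_, ⟨z, hz, rfl⟩, _, ⟨n, rfl⟩, e⟩ := Subgroup.mem_sup.1 (h hg)
  exact ⟨z, hz, n, e.symm⟩

/-- If the determinants of `genBy Z S'` are those of `genBy Z S`, every determinant of an element
of `S'` is of the form `z ^ 2 * d ^ n`. -/
lemma exists_eq_sq_mul_zpow {Z : Subgroup Fˣ} {S S' : Set (Matrix (Fin 2) (Fin 2) F)} {d d' : Fˣ}
    (hdet : (genBy Z S).map Matrix.GeneralLinearGroup.det =
      (genBy Z S').map Matrix.GeneralLinearGroup.det)
    (hS : ∀ M ∈ S, M.det = 1 ∨ M.det = d) {M : Matrix (Fin 2) (Fin 2) F} (hM : M ∈ S')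
    (hd : M.det = d') : ∃ z ∈ Z, ∃ n : ℤ, d' = z ^ 2 * d ^ n := by
  obtain ⟨g, hg, rfl⟩ := mem_matrices_genBy (Z := Z) hM (hd ▸ d'.ne_zero)
  have h : Matrix.GeneralLinearGroup.det g = d' := Units.ext hd
  obtain ⟨g', hg', e⟩ := hdet.ge (Subgroup.mem_map_of_mem _ hg)
  rw [← h, ← e]
  exact exists_det_eq_of_mem_genBy hS hg'

lemma mul_inv_mem_of_sq_eq {Z : Subgroup Fˣ} (hneg : -1 ∈ Z) {r w : Fˣ} (h : r ^ 2 = w ^ 2) :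
    r * w⁻¹ ∈ Z := by
  rcases sq_eq_sq_iff_eq_or_eq_neg.1 (congrArg Units.val h) with h | h
  · rw [show r = w from Units.ext h, mul_inv_cancel]
    exact one_mem Z
  · rw [show r = -w from Units.ext h, neg_mul, mul_inv_cancel]
    exact hneg

/-- Two elements which generate each other's squares modulo `Z` and whose cubes are in `Z`
are equal or inverse to each other modulo `Z`. -/
lemma mul_inv_mem_or_mul_mem {Z : Subgroup Fˣ} (hneg : -1 ∈ Z) {r r' : Fˣ} (hr : r ^ 3 ∈ Z)
    (hr' : r' ^ 3 ∈ Z) (h : ∃ z ∈ Z, ∃ n : ℤ, r ^ 2 = z ^ 2 * (r' ^ 2) ^ n)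
    (h' : ∃ z ∈ Z, ∃ n : ℤ, r' ^ 2 = z ^ 2 * (r ^ 2) ^ n) : r' * r⁻¹ ∈ Z ∨ r * r' ∈ Z := by
  have key : ∀ {r r' : Fˣ}, r' ^ 3 ∈ Z → (∃ z ∈ Z, ∃ n : ℤ, r ^ 2 = z ^ 2 * (r' ^ 2) ^ n) →
      r ∈ Z ∨ r' * r⁻¹ ∈ Z ∨ r * r' ∈ Z := by
    rintro r r' hr' ⟨z, hz, n, e⟩
    have h1 : r * (z * r' ^ n)⁻¹ ∈ Z := by
      refine mul_inv_mem_of_sq_eq hneg ?_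
      rw [e, mul_pow, ← zpow_natCast, ← zpow_natCast, ← zpow_natCast, ← _root_.zpow_mul,
        ← _root_.zpow_mul, mul_comm n]
    have h2 : r * (r' ^ n)⁻¹ ∈ Z := by
      have := mul_mem h1 hz
      rwa [_root_.mul_inv_rev, mul_assoc, mul_assoc, inv_mul_cancel, mul_one] at this
    have h3 : ∀ m : ℤ, r' ^ (3 * m) ∈ Z := fun m ↦ by
      rw [_root_.zpow_mul]
      exact zpow_mem (mod_cast hr') m
    have h4 : ∀ m k : ℤ, n = 3 * m + k → r * (r' ^ k)⁻¹ ∈ Z := fun m k hn ↦ by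
      have := mul_mem h2 (h3 m)
      rwa [hn, _root_.zpow_add, _root_.mul_inv_rev, mul_assoc, mul_assoc, inv_mul_cancel,
        mul_one] at this
    have h5 : n % 3 = 0 ∨ n % 3 = 1 ∨ n % 3 = 2 := by omega
    rcases h5 with hn | hn | hn
    · left
      simpa using h4 (n / 3) 0 (by omega)
    · right; left
      have := inv_mem (h4 (n / 3) 1 (by omega))
      simpa using this
    · right; right
      simpa using h4 (n / 3 + 1) (-1) (by omega)
  rcases key hr' h with h1 | h1
  · rcases key hr h' with h2 | h2 | h2
    · exact Or.inl (mul_mem h2 (inv_mem h1))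
    · left
      simpa using inv_mem h2
    · exact Or.inr (mul_comm r r' ▸ h2)
  · exact h1

/-- If `t * s ^ 2` and `t * s' ^ 2` lie in `Z` and generate each other modulo squares of elements of
`Z`, then `s` and `s'` are equal modulo `Z`. -/
lemma mul_inv_mem_of_mul_sq {Z : Subgroup Fˣ} (hneg : -1 ∈ Z) {s s' t : Fˣ}
    (hs : t * s ^ 2 ∈ Z) (hs' : t * s' ^ 2 ∈ Z)
    (h : ∃ z ∈ Z, ∃ n : ℤ, t * s ^ 2 = z ^ 2 * (t * s' ^ 2) ^ n)
    (h' : ∃ z ∈ Z, ∃ n : ℤ, t * s' ^ 2 = z ^ 2 * (t * s ^ 2) ^ n) : s' * s⁻¹ ∈ Z := by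
  have key : ∀ {d d' : Fˣ}, d' ∈ Z → (∃ z ∈ Z, ∃ n : ℤ, d = z ^ 2 * d' ^ n) →
      (∃ w ∈ Z, d = w ^ 2) ∨ ∃ w ∈ Z, d * w ^ 2 = d' := by
    rintro d d' hd' ⟨z, hz, n, e⟩
    rcases Int.even_or_odd' n with ⟨m, rfl | rfl⟩
    · refine Or.inl ⟨z * d' ^ m, mul_mem hz (zpow_mem hd' m), ?_⟩
      rw [e, mul_pow, ← zpow_natCast (d' ^ m), ← _root_.zpow_mul, mul_comm m]
      rfl
    · refine Or.inr ⟨(z * d' ^ m)⁻¹, inv_mem (mul_mem hz (zpow_mem hd' m)), ?_⟩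
      rw [e, inv_pow, mul_pow, ← zpow_natCast (d' ^ m), ← _root_.zpow_mul, mul_comm m,
        _root_.zpow_add, zpow_one, ← mul_assoc, mul_inv_eq_iff_eq_mul, mul_comm]
      rfl
  obtain ⟨w, hw, e⟩ : ∃ w ∈ Z, t * s ^ 2 * w ^ 2 = t * s' ^ 2 := by
    rcases key hs' h with ⟨w, hw, e⟩ | h1
    · rcases key hs h' with ⟨w', hw', e'⟩ | ⟨w', hw', e'⟩
      · refine ⟨w⁻¹ * w', mul_mem (inv_mem hw) hw', ?_⟩
        rw [e, e', mul_pow, inv_pow, mul_inv_cancel_left]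
      · refine ⟨w'⁻¹, inv_mem hw', ?_⟩
        rw [← e', inv_pow, mul_inv_cancel_right]
    · exact h1
  have e' : s' ^ 2 = (s * w) ^ 2 := by
    rw [mul_pow, ← mul_right_inj t, ← e, mul_assoc]
  have := mul_mem (mul_inv_mem_of_sq_eq hneg e') hw
  rwa [_root_.mul_inv_rev, ← mul_assoc, mul_right_comm, inv_mul_cancel_right] at this

variable {x y : F}

lemma det_quat_one_neg_one_ne_zero (h2 : (2 : F) ≠ 0) (hxy : x ^ 2 + y ^ 2 = -1) :
    (quat x y 0 1 (-1) 0).det ≠ 0 := by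
  rw [quat_det hxy]
  norm_num
  exact h2

/-- `i - j` conjugates `i` to `-j` and `j` to `-i`. -/
lemma conj_quat_i (hxy : x ^ 2 + y ^ 2 = -1) {K : Submonoid (Matrix (Fin 2) (Fin 2) F)}
    (hi : quat x y 0 1 0 0 ∈ K) (hj : quat x y 0 0 1 0 ∈ K) :
    (∃ N ∈ K, quat x y 0 1 (-1) 0 * quat x y 0 1 0 0 = N * quat x y 0 1 (-1) 0) ∧
    (∃ N ∈ K, quat x y 0 1 (-1) 0 * quat x y 0 0 1 0 = N * quat x y 0 1 (-1) 0) ∧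
    (∃ N ∈ K, quat x y 0 1 0 0 * quat x y 0 1 (-1) 0 = quat x y 0 1 (-1) 0 * N) ∧
    ∃ N ∈ K, quat x y 0 0 1 0 * quat x y 0 1 (-1) 0 = quat x y 0 1 (-1) 0 * N := by
  have hi' := neg_mem_of_quat_mem hxy hi hi
  have hj' := neg_mem_of_quat_mem hxy hi hj
  refine ⟨⟨_, hj', ?_⟩, ⟨_, hi', ?_⟩, ⟨_, hj', ?_⟩, ⟨_, hi', ?_⟩⟩ <;>
    rw [quat_neg, quat_mul hxy, quat_mul hxy] <;> congr 1 <;> ring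

lemma neg_quat_sq (hxy : x ^ 2 + y ^ 2 = -1) (s : F) : -(quat x y s s s s * quat x y s s s s) =
    quat x y (2 * s ^ 2) (-(2 * s ^ 2)) (-(2 * s ^ 2)) (-(2 * s ^ 2)) := by
  rw [quat_mul hxy, quat_neg]
  congr 1 <;> ring

lemma quat_one (x y : F) : quat x y 1 0 0 0 = 1 := by
  ext i j
  fin_cases i <;> fin_cases j <;> simp [quat]

lemma exists_conj_genBy_tetrahedral (h2 : (2 : F) ≠ 0) (hxy : x ^ 2 + y ^ 2 = -1)
    {Z : Subgroup Fˣ} (hneg : -1 ∈ Z) {s s' : F} (hs : s ≠ 0) (hs' : s' ≠ 0)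
    (hZ : scalars (genBy Z {quat x y 0 1 0 0, quat x y 0 0 1 0, quat x y s s s s}) ≤ Z)
    (hZ' : scalars (genBy Z {quat x y 0 1 0 0, quat x y 0 0 1 0, quat x y s' s' s' s'}) ≤ Z)
    (hdet : (genBy Z {quat x y 0 1 0 0, quat x y 0 0 1 0, quat x y s s s s}).map
        Matrix.GeneralLinearGroup.det =
      (genBy Z {quat x y 0 1 0 0, quat x y 0 0 1 0, quat x y s' s' s' s'}).map
        Matrix.GeneralLinearGroup.det) :
    ∃ P : GL (Fin 2) F,
      (genBy Z {quat x y 0 1 0 0, quat x y 0 0 1 0, quat x y s s s s}).map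
          (MulAut.conj P).toMonoidHom =
        genBy Z {quat x y 0 1 0 0, quat x y 0 0 1 0, quat x y s' s' s' s'} := by
  have hmem : ∀ {s : F}, s ≠ 0 → ∀ M ∈ ({quat x y 0 1 0 0, quat x y 0 0 1 0, quat x y s s s s} :
      Set (Matrix (Fin 2) (Fin 2) F)), M ∈ matrices
        (genBy Z {quat x y 0 1 0 0, quat x y 0 0 1 0, quat x y s s s s}) := by
    intro s hs M hM
    refine mem_matrices_genBy hM ?_
    rcases hM with rfl | rfl | rfl
    · simp [quat_det hxy]
    · simp [quat_det hxy]
    · rw [quat_det hxy]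
      convert pow_ne_zero 2 (mul_ne_zero h2 hs) using 1
      ring
  have hdet1 : ∀ r : Fˣ, ∀ s : F, (r : F) = 2 * s → ∀ M ∈ ({quat x y 0 1 0 0, quat x y 0 0 1 0,
      quat x y s s s s} : Set (Matrix (Fin 2) (Fin 2) F)), M.det = 1 ∨ M.det = (r ^ 2 : Fˣ) := by
    rintro r s hr M (rfl | rfl | rfl)
    · simp [quat_det hxy]
    · simp [quat_det hxy]
    · right
      rw [quat_det hxy, Units.val_pow_eq_pow_val, hr]
      ring
  have hcube : ∀ {s : F}, s ≠ 0 → scalars (genBy Z {quat x y 0 1 0 0, quat x y 0 0 1 0,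
      quat x y s s s s}) ≤ Z → ∀ r : Fˣ, (r : F) = 2 * s → r ^ 3 ∈ Z := by
    intro s hs hZ r hr
    have hi := hmem hs (quat x y 0 1 0 0) (by simp)
    have hq := hmem hs (quat x y s s s s) (by simp)
    refine hZ (mem_scalars_of_smul_one_mem ?_)
    convert neg_mem_of_quat_mem hxy hi (mul_mem (mul_mem hq hq) hq) using 1
    rw [quat_mul hxy, quat_mul hxy, quat_neg, ← quat_one x y, smul_quat, Units.val_pow_eq_pow_val,
      hr]
    congr 1 <;> ring
  obtain ⟨r, hr⟩ : ∃ r : Fˣ, (r : F) = 2 * s := ⟨Units.mk0 _ (mul_ne_zero h2 hs), rfl⟩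
  obtain ⟨r', hr'⟩ : ∃ r' : Fˣ, (r' : F) = 2 * s' := ⟨Units.mk0 _ (mul_ne_zero h2 hs'), rfl⟩
  have hr3 := hcube hs hZ r hr
  have hr3' := hcube hs' hZ' r' hr'
  have hi := hmem hs (quat x y 0 1 0 0) (by simp)
  have hi' := hmem hs' (quat x y 0 1 0 0) (by simp)
  have hj := hmem hs (quat x y 0 0 1 0) (by simp)
  have hj' := hmem hs' (quat x y 0 0 1 0) (by simp)
  have hq := hmem hs (quat x y s s s s) (by simp)
  have hq' := hmem hs' (quat x y s' s' s' s') (by simp)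
  have hd : ∀ r : Fˣ, ∀ s : F, (r : F) = 2 * s → (quat x y s s s s).det = (r ^ 2 : Fˣ) := by
    intro r s hr
    rw [quat_det hxy, Units.val_pow_eq_pow_val, hr]
    ring
  rcases mul_inv_mem_or_mul_mem hneg hr3 hr3'
    (exists_eq_sq_mul_zpow (d' := r ^ 2) hdet.symm (hdet1 r' s' hr')
      (M := quat x y s s s s) (by simp) (hd r s hr))
    (exists_eq_sq_mul_zpow (d' := r' ^ 2) hdet (hdet1 r s hr)
      (M := quat x y s' s' s' s') (by simp) (hd r' s' hr')) with h | h
  · have hval : ∀ r r' : Fˣ, ∀ s s' : F, (r : F) = 2 * s → (r' : F) = 2 * s' →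
        quat x y s' s' s' s' = (r' * r⁻¹).val • quat x y s s s s := by
      intro r r' s s' hr hr'
      have : s' = (r' * r⁻¹).val * s := by
        apply mul_left_cancel₀ h2
        rw [mul_left_comm, ← hr, ← hr', ← Units.val_mul, inv_mul_cancel_right]
      rw [smul_quat, ← this]
    refine ⟨1, map_conj_genBy_of_matrices 1 ?_ ?_⟩ <;> simp only [Units.val_one, one_mul, mul_one,
      exists_eq_right']
    · rintro M (rfl | rfl | rfl)
      · exact hi'
      · exact hj'
      · rw [hval r' r s' s hr' hr]
        refine smul_mem_matrices (le_scalars_genBy _ _ ?_) hq'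
        simpa using inv_mem h
    · rintro M (rfl | rfl | rfl)
      · exact hi
      · exact hj
      · rw [hval r r' s s' hr hr']
        exact smul_mem_matrices (le_scalars_genBy _ _ h) hq
  · have hu : ∀ r r' : Fˣ, ∀ s s' : F, (r : F) = 2 * s → (r' : F) = 2 * s' →
        (r * r' * (r' ^ 3)⁻¹ : Fˣ).val • -(quat x y s' s' s' s' * quat x y s' s' s' s') =
          quat x y s (-s) (-s) (-s) := by
      intro r r' s s' hr hr'
      have hs'0 : s' ≠ 0 := by
        rintro rfl
        simp at hr'
      have : (r * r' * (r' ^ 3)⁻¹ : Fˣ).val * (2 * s' ^ 2) = s := by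
        simp only [Units.val_mul, Units.val_inv_eq_inv_val, Units.val_pow_eq_pow_val, hr, hr']
        field_simp
      rw [neg_quat_sq hxy, smul_quat, mul_neg, this]
    refine ⟨Matrix.GeneralLinearGroup.mkOfDetNeZero _ (det_quat_one_neg_one_ne_zero h2 hxy),
      map_conj_genBy_of_matrices _ ?_ ?_⟩
    · rintro M (rfl | rfl | rfl)
      · exact (conj_quat_i hxy hi' hj').1
      · exact (conj_quat_i hxy hi' hj').2.1
      · refine ⟨_, smul_mem_matrices (le_scalars_genBy _ _ (mul_mem h (inv_mem hr3')))
          (neg_mem_of_quat_mem hxy hi' (mul_mem hq' hq')), ?_⟩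
        rw [hu r r' s s' hr hr']
        change quat x y 0 1 (-1) 0 * _ = _ * quat x y 0 1 (-1) 0
        rw [quat_mul hxy, quat_mul hxy]
        congr 1 <;> ring
    · rintro M (rfl | rfl | rfl)
      · exact (conj_quat_i hxy hi hj).2.2.1
      · exact (conj_quat_i hxy hi hj).2.2.2
      · refine ⟨_, smul_mem_matrices (le_scalars_genBy _ _ (mul_mem (mul_comm r r' ▸ h)
          (inv_mem hr3))) (neg_mem_of_quat_mem hxy hi (mul_mem hq hq)), ?_⟩
        rw [hu r' r s' s hr' hr]
        change _ * quat x y 0 1 (-1) 0 = quat x y 0 1 (-1) 0 * _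
        rw [quat_mul hxy, quat_mul hxy]
        congr 1 <;> ring

lemma genBy_octahedral_eq (h2 : (2 : F) ≠ 0) (hxy : x ^ 2 + y ^ 2 = -1)
    {Z : Subgroup Fˣ} (hneg : -1 ∈ Z) {s s' : F} (hs : s ≠ 0) (hs' : s' ≠ 0)
    (hZ : scalars (genBy Z {quat x y 0 1 0 0, quat x y 0 0 1 0,
      quat x y (1 / 2) (1 / 2) (1 / 2) (1 / 2), quat x y 0 s s 0}) ≤ Z)
    (hZ' : scalars (genBy Z {quat x y 0 1 0 0, quat x y 0 0 1 0,
      quat x y (1 / 2) (1 / 2) (1 / 2) (1 / 2), quat x y 0 s' s' 0}) ≤ Z)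
    (hdet : (genBy Z {quat x y 0 1 0 0, quat x y 0 0 1 0,
        quat x y (1 / 2) (1 / 2) (1 / 2) (1 / 2), quat x y 0 s s 0}).map
          Matrix.GeneralLinearGroup.det =
      (genBy Z {quat x y 0 1 0 0, quat x y 0 0 1 0,
        quat x y (1 / 2) (1 / 2) (1 / 2) (1 / 2), quat x y 0 s' s' 0}).map
          Matrix.GeneralLinearGroup.det) :
    genBy Z {quat x y 0 1 0 0, quat x y 0 0 1 0,
        quat x y (1 / 2) (1 / 2) (1 / 2) (1 / 2), quat x y 0 s s 0} =
      genBy Z {quat x y 0 1 0 0, quat x y 0 0 1 0,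
        quat x y (1 / 2) (1 / 2) (1 / 2) (1 / 2), quat x y 0 s' s' 0} := by
  lift s to Fˣ using hs.isUnit
  lift s' to Fˣ using hs'.isUnit
  set t : Fˣ := Units.mk0 2 h2 with ht
  have hd : ∀ s : Fˣ, (quat x y 0 s.val s.val 0).det = (t * s ^ 2 : Fˣ) := by
    intro s
    rw [quat_det hxy, Units.val_mul, Units.val_pow_eq_pow_val, Units.val_mk0]
    ring
  have hmem : ∀ s : Fˣ, ∀ M ∈ ({quat x y 0 1 0 0, quat x y 0 0 1 0,
      quat x y (1 / 2) (1 / 2) (1 / 2) (1 / 2), quat x y 0 s.val s.val 0} :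
      Set (Matrix (Fin 2) (Fin 2) F)), M ∈ matrices (genBy Z {quat x y 0 1 0 0, quat x y 0 0 1 0,
        quat x y (1 / 2) (1 / 2) (1 / 2) (1 / 2), quat x y 0 s.val s.val 0}) := by
    intro s M hM
    refine mem_matrices_genBy hM ?_
    rcases hM with rfl | rfl | rfl | rfl
    · simp [quat_det hxy]
    · simp [quat_det hxy]
    · exact quat_half_det_ne_zero h2 hxy
    · rw [hd]
      exact Units.ne_zero _
  have hdet1 : ∀ s : Fˣ, ∀ M ∈ ({quat x y 0 1 0 0, quat x y 0 0 1 0,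
      quat x y (1 / 2) (1 / 2) (1 / 2) (1 / 2), quat x y 0 s.val s.val 0} :
      Set (Matrix (Fin 2) (Fin 2) F)), M.det = 1 ∨ M.det = (t * s ^ 2 : Fˣ) := by
    rintro s M (rfl | rfl | rfl | rfl)
    · simp [quat_det hxy]
    · simp [quat_det hxy]
    · left
      rw [quat_det hxy]
      field_simp
      ring
    · exact Or.inr (hd s)
  have hsq : ∀ s : Fˣ, scalars (genBy Z {quat x y 0 1 0 0, quat x y 0 0 1 0,
      quat x y (1 / 2) (1 / 2) (1 / 2) (1 / 2), quat x y 0 s.val s.val 0}) ≤ Z →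
      t * s ^ 2 ∈ Z := by
    intro s hZ
    have hi := hmem s (quat x y 0 1 0 0) (by simp)
    have hq := hmem s (quat x y 0 s.val s.val 0) (by simp)
    refine hZ (mem_scalars_of_smul_one_mem ?_)
    convert neg_mem_of_quat_mem hxy hi (mul_mem hq hq) using 1
    rw [quat_mul hxy, quat_neg, ← quat_one x y, smul_quat, ← hd, quat_det hxy]
    congr 1 <;> ring
  have h : s' * s⁻¹ ∈ Z := mul_inv_mem_of_mul_sq hneg (hsq s hZ) (hsq s' hZ')
    (exists_eq_sq_mul_zpow hdet.symm (hdet1 s') (M := quat x y 0 s.val s.val 0) (by simp) (hd s))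
    (exists_eq_sq_mul_zpow hdet (hdet1 s) (M := quat x y 0 s'.val s'.val 0) (by simp) (hd s'))
  have hval : ∀ s s' : Fˣ,
      quat x y 0 s'.val s'.val 0 = (s' * s⁻¹).val • quat x y 0 s.val s.val 0 := by
    intro s s'
    rw [smul_quat, mul_zero, ← Units.val_mul, inv_mul_cancel_right]
  apply genBy_congr
  · rintro M (rfl | rfl | rfl | rfl)
    · exact hmem s' _ (by simp)
    · exact hmem s' _ (by simp)
    · exact hmem s' _ (by simp)
    · rw [hval s' s]
      refine smul_mem_matrices (le_scalars_genBy _ _ ?_) (hmem s' _ (by simp))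
      simpa using inv_mem h
  · rintro M (rfl | rfl | rfl | rfl)
    · exact hmem s _ (by simp)
    · exact hmem s _ (by simp)
    · exact hmem s _ (by simp)
    · rw [hval s s']
      exact smul_mem_matrices (le_scalars_genBy _ _ h) (hmem s _ (by simp))

lemma exists_conj_genBy_icosahedral (h2 : (2 : F) ≠ 0) (hxy : x ^ 2 + y ^ 2 = -1)
    (Z : Subgroup Fˣ) {p p' : F} (hp : p ^ 2 = p + 1) (hp' : p' ^ 2 = p' + 1) :
    ∃ P : GL (Fin 2) F,
      (genBy Z {quat x y 0 1 0 0, quat x y 0 0 1 0, quat x y (1 / 2) (1 / 2) (1 / 2) (1 / 2),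
          quat x y 0 (p / 2) ((p - 1) / 2) (1 / 2)}).map (MulAut.conj P).toMonoidHom =
        genBy Z {quat x y 0 1 0 0, quat x y 0 0 1 0, quat x y (1 / 2) (1 / 2) (1 / 2) (1 / 2),
          quat x y 0 (p' / 2) ((p' - 1) / 2) (1 / 2)} := by
  have hpp : (p' - p) * (p' + p - 1) = 0 := by linear_combination hp' - hp
  rcases mul_eq_zero.1 hpp with h | h
  · rw [sub_eq_zero.1 h]
    exact ⟨1, by ext g; simp⟩
  have hmem : ∀ {p : F}, p ^ 2 = p + 1 → ∀ M ∈ ({quat x y 0 1 0 0, quat x y 0 0 1 0,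
      quat x y (1 / 2) (1 / 2) (1 / 2) (1 / 2), quat x y 0 (p / 2) ((p - 1) / 2) (1 / 2)} :
      Set (Matrix (Fin 2) (Fin 2) F)), M ∈ matrices (genBy Z {quat x y 0 1 0 0, quat x y 0 0 1 0,
        quat x y (1 / 2) (1 / 2) (1 / 2) (1 / 2), quat x y 0 (p / 2) ((p - 1) / 2) (1 / 2)}) := by
    intro p hp M hM
    refine mem_matrices_genBy hM ?_
    rcases hM with rfl | rfl | rfl | rfl
    · simp [quat_det hxy]
    · simp [quat_det hxy]
    · exact quat_half_det_ne_zero h2 hxy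
    · exact quat_icosahedral_det_ne_zero h2 hxy hp
  have hi := hmem hp (quat x y 0 1 0 0) (by simp)
  have hi' := hmem hp' (quat x y 0 1 0 0) (by simp)
  have hj := hmem hp (quat x y 0 0 1 0) (by simp)
  have hj' := hmem hp' (quat x y 0 0 1 0) (by simp)
  have hω := hmem hp (quat x y (1 / 2) (1 / 2) (1 / 2) (1 / 2)) (by simp)
  have hω' := hmem hp' (quat x y (1 / 2) (1 / 2) (1 / 2) (1 / 2)) (by simp)
  have hu := hmem hp (quat x y 0 (p / 2) ((p - 1) / 2) (1 / 2)) (by simp)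
  have hu' := hmem hp' (quat x y 0 (p' / 2) ((p' - 1) / 2) (1 / 2)) (by simp)
  have e : p' = 1 - p := by linear_combination h
  have e2 : 2 * (1 / 2 : F) ^ 2 = 1 / 2 := by field_simp
  refine ⟨Matrix.GeneralLinearGroup.mkOfDetNeZero _ (det_quat_one_neg_one_ne_zero h2 hxy),
    map_conj_genBy_of_matrices _ ?_ ?_⟩
  · rintro M (rfl | rfl | rfl | rfl)
    · exact (conj_quat_i hxy hi' hj').1
    · exact (conj_quat_i hxy hi' hj').2.1
    · refine ⟨_, neg_mem_of_quat_mem hxy hi' (mul_mem hω' hω'), ?_⟩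
      rw [neg_quat_sq hxy, e2]
      change quat x y 0 1 (-1) 0 * _ = _ * quat x y 0 1 (-1) 0
      rw [quat_mul hxy, quat_mul hxy]
      congr 1 <;> ring
    · refine ⟨_, quat_flip_k_mem hxy (quat_k_mem hxy hi' hj') hu', ?_⟩
      change quat x y 0 1 (-1) 0 * _ = _ * quat x y 0 1 (-1) 0
      rw [quat_mul hxy, quat_mul hxy, e]
      congr 1 <;> ring
  · rintro M (rfl | rfl | rfl | rfl)
    · exact (conj_quat_i hxy hi hj).2.2.1
    · exact (conj_quat_i hxy hi hj).2.2.2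
    · refine ⟨_, neg_mem_of_quat_mem hxy hi (mul_mem hω hω), ?_⟩
      rw [neg_quat_sq hxy, e2]
      change _ * quat x y 0 1 (-1) 0 = quat x y 0 1 (-1) 0 * _
      rw [quat_mul hxy, quat_mul hxy]
      congr 1 <;> ring
    · refine ⟨_, quat_flip_k_mem hxy (quat_k_mem hxy hi hj) hu, ?_⟩
      change _ * quat x y 0 1 (-1) 0 = quat x y 0 1 (-1) 0 * _
      rw [quat_mul hxy, quat_mul hxy, e]
      congr 1 <;> ring

end Comparison

section PermutationGroups

open scoped commutatorElement

/-- The even permutation `(i j) (k l)`. -/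
def swapMulSwap {n : ℕ} (i j k l : Fin n) (hij : i ≠ j := by decide) (hkl : k ≠ l := by decide) :
    alternatingGroup (Fin n) :=
  ⟨Equiv.swap i j * Equiv.swap k l, by
    simp [Equiv.Perm.mem_alternatingGroup, Equiv.Perm.sign_swap hij, Equiv.Perm.sign_swap hkl]⟩

lemma exists_tetrahedralTriple_alternatingGroup_four : ∃ a b c : alternatingGroup (Fin 4),
    IsTetrahedralTriple a b c ∧ Subgroup.closure {a, b, c} = ⊤ := by
  refine ⟨swapMulSwap 0 1 2 3, swapMulSwap 1 2 0 3,
    swapMulSwap 0 1 1 2,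
    ⟨by decide, by decide, by decide, by decide, by decide, by decide⟩, ?_⟩
  have h : ∀ g : Equiv.Perm (Fin 4), Equiv.Perm.sign g = 1 → ∃ (i j : Fin 2) (k : Fin 3),
      (swapMulSwap 0 1 2 3).val ^ i.val * (swapMulSwap 1 2 0 3).val ^ j.val *
        (swapMulSwap 0 1 1 2).val ^ k.val = g := by
    decide
  refine eq_top_iff.2 fun g _ ↦ ?_
  obtain ⟨i, j, k, e⟩ := h g.val g.2
  have e' : swapMulSwap 0 1 2 3 ^ i.val * swapMulSwap 1 2 0 3 ^ j.val *
      swapMulSwap 0 1 1 2 ^ k.val = g := Subtype.ext e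
  rw [← e']
  exact mul_mem (mul_mem (pow_mem (Subgroup.subset_closure (by simp)) _)
    (pow_mem (Subgroup.subset_closure (by simp)) _)) (pow_mem (Subgroup.subset_closure (by simp)) _)

lemma exists_tetrahedralTriple_perm_four : ∃ a b c t : Equiv.Perm (Fin 4),
    IsTetrahedralTriple a b c ∧ t * a * t⁻¹ = b ∧ t * b * t⁻¹ = a ∧ ⁅t, c⁆ = c ∧
      Subgroup.closure {a, b, c, t} = ⊤ := by
  refine ⟨Equiv.swap 0 1 * Equiv.swap 2 3, Equiv.swap 1 2 * Equiv.swap 0 3,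
    Equiv.swap 0 1 * Equiv.swap 1 2, Equiv.swap 0 2,
    ⟨by decide, by decide, by decide, by decide, by decide, by decide⟩,
    by decide, by decide, by decide, ?_⟩
  have h : ∀ g : Equiv.Perm (Fin 4), ∃ (i j : Fin 2) (k : Fin 3) (m : Fin 2),
      (Equiv.swap 0 1 * Equiv.swap 2 3) ^ i.val * (Equiv.swap 1 2 * Equiv.swap 0 3) ^ j.val *
        (Equiv.swap 0 1 * Equiv.swap 1 2) ^ k.val * Equiv.swap 0 2 ^ m.val = g := by
    decide
  refine eq_top_iff.2 fun g _ ↦ ?_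
  obtain ⟨i, j, k, m, rfl⟩ := h g
  exact mul_mem (mul_mem (mul_mem (pow_mem (Subgroup.subset_closure (by simp)) _)
    (pow_mem (Subgroup.subset_closure (by simp)) _))
    (pow_mem (Subgroup.subset_closure (by simp)) _))
    (pow_mem (Subgroup.subset_closure (by simp)) _)

lemma eq_top_of_thirty_dvd_card {K : Subgroup (alternatingGroup (Fin 5))}
    (h : 30 ∣ Nat.card K) : K = ⊤ := by
  have hcard : Nat.card (alternatingGroup (Fin 5)) = 60 := by
    rw [nat_card_alternatingGroup, Nat.card_eq_fintype_card, Fintype.card_fin]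
    rfl
  have hmul := K.card_mul_index
  rw [hcard] at hmul
  obtain ⟨m, hm⟩ := h
  rw [hm] at hmul
  have hi : K.index ≤ 2 := by
    have : 0 < m := Nat.pos_of_ne_zero (by rintro rfl; simp at hmul)
    nlinarith
  have hi0 : K.index ≠ 0 := by
    intro h0
    simp [h0] at hmul
  rcases (by omega : K.index = 1 ∨ K.index = 2) with h1 | h1
  · exact Subgroup.index_eq_one.1 h1
  · rcases (Subgroup.normal_of_index_eq_two h1).eq_bot_or_eq_top with h | h
    · rw [h, Subgroup.index_bot, hcard] at h1
      omega
    · exact h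

lemma exists_tetrahedralTriple_alternatingGroup_five :
    ∃ a b c u p₁ q₁ p₂ q₂ : alternatingGroup (Fin 5), IsTetrahedralTriple a b c ∧
      ⁅p₁, q₁⁆ = c ∧ ⁅p₂, q₂⁆ = u ∧ u ≠ 1 ∧ u ^ 2 = 1 ∧ u * a ≠ 1 ∧ (u * a) ^ 5 = 1 ∧
      u * (a * b) ≠ 1 ∧ (u * (a * b)) ^ 3 = 1 ∧ Subgroup.closure {a, b, c, u} = ⊤ := by
  refine ⟨swapMulSwap 0 1 2 3, swapMulSwap 1 2 0 3,
    swapMulSwap 0 1 1 2, swapMulSwap 0 2 3 4,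
    swapMulSwap 1 2 3 4, swapMulSwap 0 1 3 4,
    swapMulSwap 2 3 3 4, swapMulSwap 0 3 3 2,
    ⟨by decide, by decide, by decide, by decide, by decide, by decide⟩, by decide, by decide,
    by decide, by decide, by decide, by decide, by decide, by decide, ?_⟩
  set a : alternatingGroup (Fin 5) := swapMulSwap 0 1 2 3 with ha
  set b : alternatingGroup (Fin 5) := swapMulSwap 1 2 0 3 with hb
  set c : alternatingGroup (Fin 5) := swapMulSwap 0 1 1 2 with hc
  set u : alternatingGroup (Fin 5) := swapMulSwap 0 2 3 4 with hu
  have ha' : a ∈ Subgroup.closure {a, b, c, u} := Subgroup.subset_closure (by simp)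
  have hc' : c ∈ Subgroup.closure {a, b, c, u} := Subgroup.subset_closure (by simp)
  have hu' : u ∈ Subgroup.closure {a, b, c, u} := Subgroup.subset_closure (by simp)
  have h2 : 2 ∣ Nat.card (Subgroup.closure {a, b, c, u}) := by
    have := Fact.mk Nat.prime_two
    have e : orderOf (a) = 2 := orderOf_eq_prime (by rw [ha]; decide) (by rw [ha]; decide)
    exact e.symm.dvd.trans <| Subgroup.orderOf_dvd_natCard _ ha'
  have h3 : 3 ∣ Nat.card (Subgroup.closure {a, b, c, u}) := by
    have := Fact.mk Nat.prime_three
    have e : orderOf (c) = 3 := orderOf_eq_prime (by rw [hc]; decide) (by rw [hc]; decide)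
    exact e.symm.dvd.trans <| Subgroup.orderOf_dvd_natCard _ hc'
  have h5 : 5 ∣ Nat.card (Subgroup.closure {a, b, c, u}) := by
    have := Fact.mk Nat.prime_five
    have e : orderOf (u * a) = 5 :=
      orderOf_eq_prime (by rw [hu, ha]; decide) (by rw [hu, ha]; decide)
    exact e.symm.dvd.trans <| Subgroup.orderOf_dvd_natCard _ (mul_mem hu' ha')
  exact eq_top_of_thirty_dvd_card (by omega)

end PermutationGroups

section Conjugation

open scoped commutatorElement

variable {F : Type*} [Field F]

lemma map_det_map_conj (P : GL (Fin 2) F) (K : Subgroup (GL (Fin 2) F)) :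
    (K.map (MulAut.conj P).toMonoidHom).map Matrix.GeneralLinearGroup.det =
      K.map Matrix.GeneralLinearGroup.det := by
  rw [Subgroup.map_map]
  congr 1
  ext1 g
  simp

lemma exists_map_conj_eq {K K' N N' : Subgroup (GL (Fin 2) F)} {P P' Q : GL (Fin 2) F}
    (h : K.map (MulAut.conj P).toMonoidHom = N) (h' : K'.map (MulAut.conj P').toMonoidHom = N')
    (hQ : N.map (MulAut.conj Q).toMonoidHom = N') :
    ∃ c : GL (Fin 2) F, K.map (MulAut.conj c).toMonoidHom = K' := by
  refine ⟨P'⁻¹ * Q * P, ?_⟩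
  have : K' = N'.map (MulAut.conj P'⁻¹).toMonoidHom := by
    rw [← h', Subgroup.map_map]
    convert (Subgroup.map_id K').symm
    ext1 g
    simp [mul_assoc]
  rw [this, ← hQ, ← h, Subgroup.map_map, Subgroup.map_map]
  congr 1
  ext1 g
  simp [mul_assoc]

variable {Γ Γ' H : Type*} [Group Γ] [Group Γ'] [Group H] {f : Γ →* GL (Fin 2) F} {π : Γ →* H}
  {f' : Γ' →* GL (Fin 2) F} {π' : Γ' →* H}

namespace LiftsTo

lemma exists_conj_of_tetrahedral (h : LiftsTo f π) (h' : LiftsTo f' π') (h2 : (2 : F) ≠ 0)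
    {x y : F} (hxy : x ^ 2 + y ^ 2 = -1) {a b c : H} (habc : IsTetrahedralTriple a b c)
    (hgen : Subgroup.closure {a, b, c} = ⊤) (hZ : scalars f.range = scalars f'.range)
    (hneg : -1 ∈ scalars f.range)
    (hdet : f.range.map Matrix.GeneralLinearGroup.det =
      f'.range.map Matrix.GeneralLinearGroup.det) :
    ∃ P : GL (Fin 2) F, f.range.map (MulAut.conj P).toMonoidHom = f'.range := by
  obtain ⟨P, s, hs, e⟩ := h.exists_genBy_tetrahedral h2 hxy habc hgen
  obtain ⟨P', s', hs', e'⟩ := h'.exists_genBy_tetrahedral h2 hxy habc hgen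
  rw [← hZ] at e'
  obtain ⟨Q, hQ⟩ := exists_conj_genBy_tetrahedral h2 hxy hneg hs hs'
    (by rw [← e, scalars_map_conj]) (by rw [← e', scalars_map_conj, hZ])
    (by rw [← e, ← e', map_det_map_conj, map_det_map_conj, hdet])
  exact exists_map_conj_eq e e' hQ

lemma exists_conj_of_octahedral (h : LiftsTo f π) (h' : LiftsTo f' π') (h2 : (2 : F) ≠ 0)
    {x y : F} (hxy : x ^ 2 + y ^ 2 = -1) {a b c t : H} (habc : IsTetrahedralTriple a b c)
    (hta : t * a * t⁻¹ = b) (htb : t * b * t⁻¹ = a) (htc : ⁅t, c⁆ = c)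
    (hgen : Subgroup.closure {a, b, c, t} = ⊤) (hZ : scalars f.range = scalars f'.range)
    (hneg : -1 ∈ scalars f.range)
    (hdet : f.range.map Matrix.GeneralLinearGroup.det =
      f'.range.map Matrix.GeneralLinearGroup.det) :
    ∃ P : GL (Fin 2) F, f.range.map (MulAut.conj P).toMonoidHom = f'.range := by
  obtain ⟨P, s, hs, e⟩ := h.exists_genBy_octahedral h2 hxy habc hta htb htc hgen
  obtain ⟨P', s', hs', e'⟩ := h'.exists_genBy_octahedral h2 hxy habc hta htb htc hgen
  rw [← hZ] at e'
  have hN := genBy_octahedral_eq h2 hxy hneg hs hs'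
    (by rw [← e, scalars_map_conj]) (by rw [← e', scalars_map_conj, hZ])
    (by rw [← e, ← e', map_det_map_conj, map_det_map_conj, hdet])
  exact exists_map_conj_eq (Q := 1) e e' (by rw [hN]; ext g; simp)

lemma exists_conj_of_icosahedral (h : LiftsTo f π) (h' : LiftsTo f' π') (h2 : (2 : F) ≠ 0)
    {x y : F} (hxy : x ^ 2 + y ^ 2 = -1) {a b c u p₁ q₁ p₂ q₂ : H}
    (habc : IsTetrahedralTriple a b c) (hc : ⁅p₁, q₁⁆ = c) (hu : ⁅p₂, q₂⁆ = u) (hu1 : u ≠ 1)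
    (hu2 : u ^ 2 = 1) (hua1 : u * a ≠ 1) (hua5 : (u * a) ^ 5 = 1) (huab1 : u * (a * b) ≠ 1)
    (huab3 : (u * (a * b)) ^ 3 = 1) (hgen : Subgroup.closure {a, b, c, u} = ⊤)
    (hZ : scalars f.range = scalars f'.range) :
    ∃ P : GL (Fin 2) F, f.range.map (MulAut.conj P).toMonoidHom = f'.range := by
  obtain ⟨P, p, hp, e⟩ :=
    h.exists_genBy_icosahedral h2 hxy habc hc hu hu1 hu2 hua1 hua5 huab1 huab3 hgen
  obtain ⟨P', p', hp', e'⟩ :=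
    h'.exists_genBy_icosahedral h2 hxy habc hc hu hu1 hu2 hua1 hua5 huab1 huab3 hgen
  rw [← hZ] at e'
  obtain ⟨Q, hQ⟩ := exists_conj_genBy_icosahedral h2 hxy (scalars f.range) hp hp'
  exact exists_map_conj_eq e e' hQ

end LiftsTo

end Conjugation

lemma liftsTo_subtype {ℓ : ℕ} [Fact ℓ.Prime] {H : Type*} [Group H] (G : Subgroup (GL2 ℓ))
    (e : G.map (QuotientGroup.mk' (Subgroup.center (GL2 ℓ))) ≃* H) : LiftsTo G.subtype
      (e.toMonoidHom.comp ((QuotientGroup.mk' (Subgroup.center (GL2 ℓ))).subgroupMap G)) where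
  surjective := e.surjective.comp (MonoidHom.subgroupMap_surjective _ G)
  eq_one_iff g := by
    rw [MonoidHom.comp_apply, MulEquiv.coe_toMonoidHom, map_eq_one_iff e e.injective,
      ← Subtype.val_inj]
    exact QuotientGroup.eq_one_iff (g : GL2 ℓ)

lemma scalars_eq_of_isScalarElt {ℓ : ℕ} [Fact ℓ.Prime] {G G' : Subgroup (GL2 ℓ)}
    (hZ : {g : GL2 ℓ | g ∈ G ∧ IsScalarElt g} = {g : GL2 ℓ | g ∈ G' ∧ IsScalarElt g}) :
    scalars G = scalars G' := by
  ext u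
  have hu : IsScalarElt (Matrix.GeneralLinearGroup.scalar (Fin 2) u) := by
    simp [IsScalarElt, mat]
  have := Set.ext_iff.1 hZ (Matrix.GeneralLinearGroup.scalar (Fin 2) u)
  simp only [Set.mem_ofPred_eq, hu, and_true] at this
  exact this

lemma map_det_eq_of_detSet {ℓ : ℕ} [Fact ℓ.Prime] {G G' : Subgroup (GL2 ℓ)}
    (hdet : detSet G = detSet G') :
    G.map Matrix.GeneralLinearGroup.det = G'.map Matrix.GeneralLinearGroup.det := by
  have key : ∀ (G : Subgroup (GL2 ℓ)) (d : (ZMod ℓ)ˣ),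
      d ∈ G.map Matrix.GeneralLinearGroup.det ↔ d.val ∈ detSet G := fun G d ↦
    exists_congr fun g ↦ and_congr_right fun _ ↦ Units.ext_iff
  ext d
  rw [key, key, hdet]

/-- Let `ℓ ≥ 5` be prime and let `H₀` be one of `A₄`, `S₄`, `A₅`.  If `G` and `G'` are
subgroups of `GL₂(ℤ/ℓℤ)` whose images in `PGL₂(ℤ/ℓℤ)` are both isomorphic to `H₀`, whose
scalar subgroups coincide and contain `−1`, and whose determinant images coincide, then
`G` and `G'` are conjugate in `GL₂(ℤ/ℓℤ)`. -/
theorem stmt12 (ℓ : ℕ) [Fact (Nat.Prime ℓ)] (hℓ : 5 ≤ ℓ)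
    (G G' : Subgroup (GL2 ℓ))
    (hH : (Nonempty (↥(projImage G) ≃* ↥(alternatingGroup (Fin 4))) ∧
           Nonempty (↥(projImage G') ≃* ↥(alternatingGroup (Fin 4)))) ∨
          (Nonempty (↥(projImage G) ≃* Equiv.Perm (Fin 4)) ∧
           Nonempty (↥(projImage G') ≃* Equiv.Perm (Fin 4))) ∨
          (Nonempty (↥(projImage G) ≃* ↥(alternatingGroup (Fin 5))) ∧
           Nonempty (↥(projImage G') ≃* ↥(alternatingGroup (Fin 5)))))
    (hZ : {g : GL2 ℓ | g ∈ G ∧ IsScalarElt g} = {g : GL2 ℓ | g ∈ G' ∧ IsScalarElt g})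
    (hneg : (-1 : GL2 ℓ) ∈ G ∧ (-1 : GL2 ℓ) ∈ G')
    (hdet : detSet G = detSet G') :
    ∃ c : GL2 ℓ, Subgroup.map (MulAut.conj c).toMonoidHom G = G' := by

  obtain ⟨x, y, hxy⟩ := ZMod.sq_add_sq ℓ (-1)
  have h2 : (2 : ZMod ℓ) ≠ 0 := by
    intro h
    have := Nat.le_of_dvd two_pos ((ZMod.natCast_eq_zero_iff 2 ℓ).1 (mod_cast h))
    omega
  have hZ' : scalars G.subtype.range = scalars G'.subtype.range := by
    rw [Subgroup.range_subtype, Subgroup.range_subtype]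
    exact scalars_eq_of_isScalarElt hZ
  have hneg' : -1 ∈ scalars G.subtype.range := by
    rw [Subgroup.range_subtype]
    change Matrix.GeneralLinearGroup.scalar (Fin 2) (-1) ∈ G
    convert hneg.1
    ext i j
    fin_cases i <;> fin_cases j <;> simp
  have hdet' : G.subtype.range.map Matrix.GeneralLinearGroup.det =
      G'.subtype.range.map Matrix.GeneralLinearGroup.det := by
    rw [Subgroup.range_subtype, Subgroup.range_subtype]
    exact map_det_eq_of_detSet hdet
  suffices h : ∃ c : GL2 ℓ,
      G.subtype.range.map (MulAut.conj c).toMonoidHom = G'.subtype.range by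
    simpa only [Subgroup.range_subtype] using h
  rcases hH with ⟨⟨e⟩, ⟨e'⟩⟩ | ⟨⟨e⟩, ⟨e'⟩⟩ | ⟨⟨e⟩, ⟨e'⟩⟩
  · obtain ⟨a, b, c, habc, hgen⟩ := exists_tetrahedralTriple_alternatingGroup_four
    exact (liftsTo_subtype G e).exists_conj_of_tetrahedral (liftsTo_subtype G' e') h2 hxy habc hgen
      hZ' hneg' hdet'
  · obtain ⟨a, b, c, t, habc, hta, htb, htc, hgen⟩ := exists_tetrahedralTriple_perm_four
    exact (liftsTo_subtype G e).exists_conj_of_octahedral (liftsTo_subtype G' e') h2 hxy habc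
      hta htb htc hgen hZ' hneg' hdet'
  · obtain ⟨a, b, c, u, p₁, q₁, p₂, q₂, habc, hc, hu, hu1, hu2, hua1, hua5, huab1, huab3, hgen⟩ :=
      exists_tetrahedralTriple_alternatingGroup_five
    exact (liftsTo_subtype G e).exists_conj_of_icosahedral (liftsTo_subtype G' e') h2 hxy habc
      hc hu hu1 hu2 hua1 hua5 huab1 huab3 hgen hZ'
end
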